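/- Let n be a positive integer, c a vector of n polynomials with integer coefficients, and let I be a finite index set; for each i ∈ I let A_i be a p_i × n matrix of polynomials with integer coefficients and b_i a vector of p_i such polynomials. For each positive integer t let R(t) = ⋃_{i ∈ I} {x ∈ ℝ^n : A_i(t)x ≤ b_i(t)} and L(t) = R(t) ∩ ℤ^n, and assume R(t) is bounded for every positive integer t. Then the size function g(t) = |L(t)| is eventually quasi-polynomial, and for every positive integer ℓ the function f_ℓ, where f_ℓ(t) is the ℓ-th largest value with multiplicity of c(t)·x over x ∈ L(t) (or −∞ if |L(t)| < ℓ), is eventually quasi-polynomial. -/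

import Mathlib

/-- Evaluation of an integer polynomial at a positive integer `t`. -/
def evalAt (p : Polynomial ℤ) (t : ℕ) : ℤ := p.eval (t : ℤ)

/-- A function `f` (on sufficiently large positive integers) is eventually
quasi-polynomial if there are a period `d > 0` and rational polynomials `R₀, …, R_{d-1}`
with `f t = R_{t mod d}(t)` for all sufficiently large `t`. -/
def IsEQP (f : ℕ → ℤ) : Prop :=
  ∃ d : ℕ, 0 < d ∧ ∃ R : ℕ → Polynomial ℚ, ∃ N : ℕ,
    ∀ t : ℕ, N ≤ t → (f t : ℚ) = (R (t % d)).eval (t : ℚ)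

/-- Eventual quasi-polynomiality for functions with values in `ℤ ∪ {−∞}`. -/
def IsEQPBot (f : ℕ → WithBot ℤ) : Prop :=
  ∃ d : ℕ, 0 < d ∧ ∀ r : ℕ, r < d →
    (∃ R : Polynomial ℚ, ∃ N : ℕ, ∀ t : ℕ, N ≤ t → t % d = r →
      ∃ z : ℤ, f t = (z : WithBot ℤ) ∧ (z : ℚ) = R.eval (t : ℚ)) ∨
    (∃ N : ℕ, ∀ t : ℕ, N ≤ t → t % d = r → f t = ⊥)

/-- `v` is the `ℓ`-th largest value, with multiplicity, of `obj` over `S`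
(`v = ⊥` when `S` has fewer than `ℓ` elements). -/
def IsKthLargest {α : Type*} (S : Set α) (obj : α → ℤ) (ℓ : ℕ) (v : WithBot ℤ) : Prop :=
  (S.ncard < ℓ ∧ v = ⊥) ∨
  (ℓ ≤ S.ncard ∧ ∃ z : ℤ, v = (z : WithBot ℤ) ∧
    {x ∈ S | z < obj x}.ncard < ℓ ∧ ℓ ≤ {x ∈ S | z ≤ obj x}.ncard)

/-- The lattice points of the finite union of parametric polyhedra
`⋃ i, {x : Aᵢ(t) x ≤ bᵢ(t)}`. -/
def latticeUnion {n : ℕ} {ι : Type*} {p : ι → ℕ}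
    (A : ∀ i, Matrix (Fin (p i)) (Fin n) (Polynomial ℤ))
    (b : ∀ i, Fin (p i) → Polynomial ℤ) (t : ℕ) : Set (Fin n → ℤ) :=
  {x | ∃ i, ∀ k, ∑ j, evalAt (A i k j) t * x j ≤ evalAt (b i k) t}


/-- Internal version of eventual quasi-polynomiality. -/
def QP (f : ℕ → ℚ) : Prop :=
  ∃ d : ℕ, 0 < d ∧ ∀ r : ℕ, ∃ R : Polynomial ℚ, ∃ N : ℕ, ∀ m : ℕ, N ≤ m →
    f (r + d * m) = R.eval (m : ℚ)

theorem QP.refine {f : ℕ → ℚ} {d : ℕ} (h : ∀ r : ℕ, ∃ R : Polynomial ℚ, ∃ N : ℕ, ∀ m : ℕ, N ≤ m →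
    f (r + d * m) = R.eval (m : ℚ)) (e : ℕ) (he : 0 < e) (r : ℕ) :
    ∃ R : Polynomial ℚ, ∃ N : ℕ, ∀ m : ℕ, N ≤ m →
    f (r + d * e * m) = R.eval (m : ℚ) := by
  obtain ⟨R, N, hR⟩ := h r
  refine ⟨R.comp (Polynomial.C (e : ℚ) * Polynomial.X), N, fun m hm => ?_⟩
  have := hR (e * m) (le_trans hm (Nat.le_mul_of_pos_left m he))
  rw [mul_assoc, this]
  simp

theorem QP.map₂ {f g : ℕ → ℚ} (hf : QP f) (hg : QP g) (op : ℚ → ℚ → ℚ)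
    (op' : Polynomial ℚ → Polynomial ℚ → Polynomial ℚ)
    (h : ∀ P Q x, (op' P Q).eval x = op (P.eval x) (Q.eval x)) :
    QP (fun t => op (f t) (g t)) := by
  obtain ⟨d, hd, hf⟩ := hf
  obtain ⟨e, he, hg⟩ := hg
  refine ⟨d * e, Nat.mul_pos hd he, fun r => ?_⟩
  obtain ⟨R, N, hR⟩ := QP.refine hf e he r
  obtain ⟨R', N', hR'⟩ := QP.refine hg d hd r
  refine ⟨op' R R', max N N', fun m hm => ?_⟩
  have h1 := hR m (le_trans (le_max_left _ _) hm)
  have h2 := hR' m (le_trans (le_max_right _ _) hm)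
  rw [mul_comm e d] at h2
  simp only [h, h1, h2]

theorem QP.add {f g : ℕ → ℚ} (hf : QP f) (hg : QP g) : QP (fun t => f t + g t) :=
  hf.map₂ hg (· + ·) (· + ·) (by simp)

theorem QP.mul {f g : ℕ → ℚ} (hf : QP f) (hg : QP g) : QP (fun t => f t * g t) :=
  hf.map₂ hg (· * ·) (· * ·) (by simp)

theorem QP.poly (P : Polynomial ℚ) : QP (fun t => P.eval (t : ℚ)) := by
  refine ⟨1, one_pos, fun r => ⟨P.comp (Polynomial.C (r : ℚ) + Polynomial.X), 0, fun m _ => ?_⟩⟩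
  simp

theorem QP.const (c : ℚ) : QP (fun _ => c) := by
  simpa using QP.poly (Polynomial.C c)

theorem QP.sum {α : Type*} (s : Finset α) {f : α → ℕ → ℚ} (h : ∀ a ∈ s, QP (f a)) :
    QP (fun t => ∑ a ∈ s, f a t) := by
  classical
  induction s using Finset.induction_on with
  | empty => simpa using QP.const 0
  | insert a s ha ih =>
    simp only [Finset.sum_insert ha]
    exact (h a (by simp)).add (ih fun b hb => h b (by simp [hb]))

theorem QP.shift {f : ℕ → ℚ} (hf : QP f) (w : ℕ) : QP (fun t => f (t + w)) := by
  obtain ⟨d, hd, hf⟩ := hf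
  refine ⟨d, hd, fun r => ?_⟩
  obtain ⟨R, N, hR⟩ := hf (r + w)
  refine ⟨R, N, fun m hm => ?_⟩
  rw [← hR m hm]
  change f (r + d * m + w) = _
  congr 1
  ring

theorem QP.unshift {f : ℕ → ℚ} (w : ℕ) (hf : QP (fun t => f (t + w))) : QP f := by
  obtain ⟨d, hd, hf⟩ := hf
  refine ⟨d, hd, fun r => ?_⟩
  obtain ⟨R, N, hR⟩ := hf (r + d * w - w)
  refine ⟨R.comp (Polynomial.X - Polynomial.C (w : ℚ)), N + w, fun m hm => ?_⟩
  have hw : w ≤ d * w := Nat.le_mul_of_pos_left w hd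
  have := hR (m - w) (by omega)
  obtain ⟨m', rfl⟩ : ∃ m', m = m' + w := ⟨m - w, by omega⟩
  simp only [Nat.add_sub_cancel] at this
  have e : r + d * w - w + d * m' + w = r + d * (m' + w) := by
    rw [mul_add]; omega
  rw [e] at this
  rw [this]
  simp

theorem QP.congr_eventually {f g : ℕ → ℚ} (hf : QP f) (N₀ : ℕ) (h : ∀ t, N₀ ≤ t → f t = g t) :
    QP g := by
  obtain ⟨d, hd, hf⟩ := hf
  refine ⟨d, hd, fun r => ?_⟩
  obtain ⟨R, N, hR⟩ := hf r
  refine ⟨R, max N N₀, fun m hm => ?_⟩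
  rw [← hR m (le_trans (le_max_left _ _) hm), h]
  have h1 : N₀ ≤ m := le_trans (le_max_right _ _) hm
  have h2 : m ≤ d * m := Nat.le_mul_of_pos_left m hd
  omega

theorem exists_antidiff (P : Polynomial ℚ) :
    ∃ Q : Polynomial ℚ, ∀ x : ℚ, Q.eval (x + 1) = Q.eval x + P.eval x := by
  induction P using Polynomial.induction_on' with
  | add p q hp hq =>
    obtain ⟨P', hP⟩ := hp
    obtain ⟨Q', hQ⟩ := hq
    refine ⟨P' + Q', fun x => ?_⟩
    simp only [Polynomial.eval_add, hP, hQ]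
    ring
  | monomial n a =>
    refine ⟨Polynomial.C (a / (n + 1)) * Polynomial.bernoulli (n + 1), fun x => ?_⟩
    have h := Polynomial.bernoulli_eval_one_add (n + 1) x
    rw [add_comm x 1]
    simp only [Polynomial.eval_mul, Polynomial.eval_C, h, Polynomial.eval_monomial]
    have : (n : ℚ) + 1 ≠ 0 := by positivity
    push_cast
    field_simp

theorem QP.of_diff {f g : ℕ → ℚ} (w : ℕ) (hw : 0 < w) (hg : QP g)
    (h : ∀ s, f (s + w) = f s + g s) : QP f := by
  obtain ⟨d, hd, hg⟩ := hg
  refine ⟨d * w, Nat.mul_pos hd hw, fun r => ?_⟩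
  choose R N hR using hg
  have hiter : ∀ (k s : ℕ), f (s + k * w) = f s + ∑ i ∈ Finset.range k, g (s + i * w) := by
    intro k s
    induction k with
    | zero => simp
    | succ k ih =>
      rw [Finset.sum_range_succ, ← add_assoc, ← ih, ← h]
      congr 1
      ring
  let P : Polynomial ℚ := ∑ i ∈ Finset.range d,
    (R (r + i * w)).comp (Polynomial.C (w : ℚ) * Polynomial.X)
  obtain ⟨Q, hQ⟩ := exists_antidiff P
  let N₀ := ∑ i ∈ Finset.range d, N (r + i * w)
  have hstep : ∀ m, N₀ ≤ m → f (r + d * w * (m + 1)) = f (r + d * w * m) + P.eval (m : ℚ) := by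
    intro m hm
    have e : r + d * w * (m + 1) = (r + d * w * m) + d * w := by ring
    rw [e, hiter]
    congr 1
    simp only [P, Polynomial.eval_finsetSum]
    refine Finset.sum_congr rfl fun i hi => ?_
    have hNi : N (r + i * w) ≤ N₀ := Finset.single_le_sum (f := fun i => N (r + i * w))
      (fun _ _ => Nat.zero_le _) hi
    have := hR (r + i * w) (w * m)
      (le_trans (le_trans hNi hm) (Nat.le_mul_of_pos_left m hw))
    have e2 : r + d * w * m + i * w = r + i * w + d * (w * m) := by ring
    rw [e2, this]
    simp
  refine ⟨Q + Polynomial.C (f (r + d * w * N₀) - Q.eval (N₀ : ℚ)), N₀, fun m hm => ?_⟩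
  induction m, hm using Nat.le_induction with
  | base => simp
  | succ m hm ih =>
    rw [hstep m hm, ih]
    push_cast
    simp only [Polynomial.eval_add, Polynomial.eval_C, hQ]
    ring

/-- Reparametrisation: a polynomial in `m`, as a polynomial in `r + d * m`. -/
theorem reparam (R : Polynomial ℚ) (d : ℕ) (hd : 0 < d) (r : ℕ) :
    ∃ R' : Polynomial ℚ, ∀ m : ℕ, R'.eval ((r + d * m : ℕ) : ℚ) = R.eval (m : ℚ) := by
  refine ⟨R.comp (Polynomial.C (1 / (d : ℚ)) * (Polynomial.X - Polynomial.C (r : ℚ))), fun m => ?_⟩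
  have : (d : ℚ) ≠ 0 := by positivity
  simp only [Polynomial.eval_comp, Polynomial.eval_mul, Polynomial.eval_C, Polynomial.eval_sub,
    Polynomial.eval_X]
  push_cast
  congr 1
  field_simp
  ring

theorem QP.isEQP {f : ℕ → ℤ} (h : QP (fun t => (f t : ℚ))) :
    ∃ d : ℕ, 0 < d ∧ ∃ R : ℕ → Polynomial ℚ, ∃ N : ℕ,
    ∀ t : ℕ, N ≤ t → (f t : ℚ) = (R (t % d)).eval (t : ℚ) := by
  obtain ⟨d, hd, h⟩ := h
  choose R N hR using h
  choose R' hR' using fun r => reparam (R r) d hd r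
  refine ⟨d, hd, R', d * (∑ r ∈ Finset.range d, N r) + d, fun t ht => ?_⟩
  have e : t % d + d * (t / d) = t := Nat.mod_add_div t d
  have hm : t % d < d := Nat.mod_lt _ hd
  have hN : N (t % d) ≤ ∑ r ∈ Finset.range d, N r :=
    Finset.single_le_sum (f := N) (fun _ _ => Nat.zero_le _) (Finset.mem_range.2 hm)
  have h1 : N (t % d) ≤ t / d := by
    refine le_trans hN ?_
    rw [Nat.le_div_iff_mul_le hd, mul_comm]
    omega
  have h2 := hR (t % d) (t / d) h1
  have h3 := hR' (t % d) (t / d)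
  rw [e] at h2 h3
  rw [h3]
  exact h2

theorem dickson {α β : Type*} [PartialOrder β] [WellQuasiOrderedLE β] (φ : α → β) (s : Set α) :
    ∃ B : Set α, B.Finite ∧ B ⊆ s ∧ ∀ z ∈ s, ∃ b ∈ B, φ b ≤ φ z := by
  let m : Set β := {x | Minimal (· ∈ φ '' s) x}
  have hm : m.Finite := by
    apply WellQuasiOrderedLE.finite_of_isAntichain
    exact setOfPred_minimal_antichain _
  have hms : ∀ x ∈ m, ∃ a ∈ s, φ a = x := fun x hx => hx.prop
  choose g hg hg' using hms
  have hmf : Finite m := hm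
  refine ⟨Set.range fun x : m => g x.1 x.2, Set.finite_range _, ?_, fun z hz => ?_⟩
  · rintro _ ⟨x, rfl⟩
    exact hg x.1 x.2
  · obtain ⟨x, hxz, hx⟩ := exists_minimal_le_of_wellFoundedLT (· ∈ φ '' s) (φ z) ⟨z, hz, rfl⟩
    exact ⟨g x hx, ⟨⟨x, hx⟩, rfl⟩, by rw [hg' x hx]; exact hxz⟩

theorem upper_stab {β : Type*} [PartialOrder β] [WellQuasiOrderedLE β] (U : ℕ → Set β)
    (hU : ∀ j, IsUpperSet (U j)) (hmono : Monotone U) : ∃ J, ∀ j, U j ⊆ U J := by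
  obtain ⟨B, hB, hBs, h⟩ := dickson (id : β → β) (⋃ j, U j)
  have : ∃ J, B ⊆ U J := by
    have h1 : ∀ b ∈ B, ∃ j, b ∈ U j := fun b hb => by simpa using hBs hb
    choose! f hf using h1
    refine ⟨∑ b ∈ hB.toFinset, f b, fun b hb => ?_⟩
    refine hmono ?_ (hf b hb)
    exact Finset.single_le_sum (f := f) (fun _ _ => Nat.zero_le _) (by simpa using hb)
  obtain ⟨J, hJ⟩ := this
  refine ⟨J, fun j x hx => ?_⟩
  obtain ⟨b, hb, hbx⟩ := h x (Set.mem_iUnion.2 ⟨j, hx⟩)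
  exact hU J hbx (hJ hb)

/-- number of points of weight `s` in `D`. -/
noncomputable def wcount {k : ℕ} (w : Fin k → ℕ) (D : Set (Fin k → ℕ)) (s : ℕ) : ℚ :=
  ({x | x ∈ D ∧ ∑ j, w j * x j = s} : Set (Fin k → ℕ)).ncard

theorem wfin {k : ℕ} (w : Fin k → ℕ) (hw : ∀ j, 0 < w j) (D : Set (Fin k → ℕ)) (s : ℕ) :
    ({x | x ∈ D ∧ ∑ j, w j * x j = s} : Set (Fin k → ℕ)).Finite := by
  refine (Set.finite_Iic (fun _ : Fin k => s)).subset ?_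
  rintro x ⟨-, hx⟩ j
  have : w j * x j ≤ s := hx ▸ Finset.single_le_sum (f := fun j => w j * x j)
    (fun _ _ => Nat.zero_le _) (Finset.mem_univ j)
  exact le_trans (Nat.le_mul_of_pos_left _ (hw j)) this

/-- shift down in the zeroth coordinate -/
def shiftD {k : ℕ} (D : Set (Fin (k + 1) → ℕ)) : Set (Fin (k + 1) → ℕ) :=
  {x | Fin.cons (x 0 + 1) (Fin.tail x) ∈ D}

def sliceD {k : ℕ} (D : Set (Fin (k + 1) → ℕ)) : Set (Fin k → ℕ) :=
  {x | Fin.cons 0 x ∈ D}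

theorem wcount_rec {k : ℕ} (w : Fin (k + 1) → ℕ) (hw : ∀ j, 0 < w j) (D : Set (Fin (k + 1) → ℕ))
    (s : ℕ) : wcount w D (s + w 0) =
      wcount w (shiftD D) s + wcount (Fin.tail w) (sliceD D) (s + w 0) := by
  unfold wcount
  rw [← Nat.cast_add, Nat.cast_inj]
  have i1 : Function.Injective (fun x : Fin (k + 1) → ℕ =>
      (Fin.cons (x 0 + 1) (Fin.tail x) : Fin (k + 1) → ℕ)) := by
    intro x y h
    have h0 := congrFun h 0
    simp only [Fin.cons_zero, Nat.add_right_cancel_iff] at h0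
    funext j
    refine Fin.cases h0 (fun j => ?_) j
    have := congrFun h j.succ
    simpa [Fin.tail] using this
  have i2 : Function.Injective (fun x : Fin k → ℕ => (Fin.cons 0 x : Fin (k + 1) → ℕ)) :=
    Fin.cons_right_injective (α := fun _ => ℕ) 0
  rw [← Set.ncard_image_of_injective {x | x ∈ shiftD D ∧ ∑ j, w j * x j = s} i1,
    ← Set.ncard_image_of_injective {x | x ∈ sliceD D ∧ ∑ j, Fin.tail w j * x j = s + w 0} i2,
    ← Set.ncard_union_eq ?_ ((wfin w hw _ _).image _)
      ((wfin (Fin.tail w) (fun j => hw _) _ _).image _)]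
  · congr 1
    ext x
    simp only [Set.mem_ofPred_eq, Set.mem_union, Set.mem_image]
    constructor
    · rintro ⟨hx, hs⟩
      rw [Fin.sum_univ_succ] at hs
      rcases hx0 : x 0 with _ | a
      · right
        refine ⟨Fin.tail x, ⟨?_, ?_⟩, ?_⟩
        · change Fin.cons 0 (Fin.tail x) ∈ D
          rw [← hx0, Fin.cons_self_tail]; exact hx
        · rw [hx0] at hs
          simpa [Fin.tail] using hs
        · rw [← hx0, Fin.cons_self_tail]
      · left
        refine ⟨Fin.cons a (Fin.tail x), ⟨?_, ?_⟩, ?_⟩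
        · change Fin.cons _ _ ∈ D
          simp only [Fin.cons_zero, Fin.tail_cons]
          rw [← hx0, Fin.cons_self_tail]; exact hx
        · rw [Fin.sum_univ_succ]
          rw [hx0] at hs
          simp only [Fin.cons_zero, Fin.cons_succ, Fin.tail]
          rw [mul_add] at hs
          omega
        · simp only [Fin.cons_zero, Fin.tail_cons]
          rw [← hx0, Fin.cons_self_tail]
    · rintro (⟨y, ⟨hy, hs⟩, rfl⟩ | ⟨y, ⟨hy, hs⟩, rfl⟩)
      · refine ⟨hy, ?_⟩
        rw [Fin.sum_univ_succ] at hs ⊢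
        simp only [Fin.cons_zero, Fin.cons_succ, Fin.tail, mul_add]
        omega
      · refine ⟨hy, ?_⟩
        rw [Fin.sum_univ_succ]
        simpa [Fin.tail] using hs
  · rw [Set.disjoint_left]
    rintro _ ⟨y, _, rfl⟩ ⟨z, _, hz⟩
    have := congrFun hz 0
    simp at this

theorem shiftD_lower {k : ℕ} {D : Set (Fin (k + 1) → ℕ)} (hD : IsLowerSet D) :
    IsLowerSet (shiftD D) := by
  intro x y hyx hx
  refine hD ?_ hx
  intro j
  refine Fin.cases ?_ (fun j => ?_) j
  · simpa using hyx 0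
  · simpa [Fin.tail] using hyx j.succ

theorem sliceD_lower {k : ℕ} {D : Set (Fin (k + 1) → ℕ)} (hD : IsLowerSet D) :
    IsLowerSet (sliceD D) := by
  intro x y hyx hx
  refine hD ?_ hx
  intro j
  refine Fin.cases ?_ (fun j => ?_) j
  · simp
  · simpa using hyx j

theorem shiftD_sub {k : ℕ} {D : Set (Fin (k + 1) → ℕ)} (hD : IsLowerSet D) :
    shiftD D ⊆ D := by
  intro x hx
  refine hD ?_ hx
  intro j
  refine Fin.cases ?_ (fun j => ?_) j
  · simp
  · simp [Fin.tail]

theorem wcount_qp (k : ℕ) : ∀ (w : Fin k → ℕ) (_ : ∀ j, 0 < w j) (D : Set (Fin k → ℕ))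
    (_ : IsLowerSet D), QP (wcount w D) := by
  induction k with
  | zero =>
    intro w hw D hD
    refine (QP.const 0).congr_eventually 1 fun t ht => ?_
    unfold wcount
    have : ({x | x ∈ D ∧ ∑ j, w j * x j = t} : Set (Fin 0 → ℕ)) = ∅ := by
      ext x
      simp
      intro _ h
      omega
    rw [this]
    simp
  | succ k ih =>
    intro w hw D hD
    have key : ∀ J : ℕ, ∀ D : Set (Fin (k + 1) → ℕ), IsLowerSet D →
        shiftD (shiftD^[J] D) = shiftD^[J] D → QP (wcount w D) := by
      intro J
      induction J with
      | zero =>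
        intro D hD h
        simp only [Function.iterate_zero, id] at h
        refine QP.of_diff (w 0) (hw 0)
          ((ih (Fin.tail w) (fun j => hw _) _ (sliceD_lower hD)).shift (w 0)) fun s => ?_
        rw [wcount_rec w hw, h]
      | succ J ihJ =>
        intro D hD h
        rw [Function.iterate_succ_apply] at h
        have h1 := ihJ (shiftD D) (shiftD_lower hD) h
        apply QP.unshift (w 0)
        have h2 := h1.add ((ih (Fin.tail w) (fun j => hw _) _ (sliceD_lower hD)).shift (w 0))
        simpa only [wcount_rec w hw] using h2
    have hlow : ∀ J, IsLowerSet (shiftD^[J] D) := by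
      intro J
      induction J with
      | zero => exact hD
      | succ J ihJ => rw [Function.iterate_succ_apply']; exact shiftD_lower ihJ
    obtain ⟨J, hJ⟩ := upper_stab (fun J => (shiftD^[J] D)ᶜ) (fun J => (hlow J).compl) (by
      apply monotone_nat_of_le_succ
      intro J
      rw [Function.iterate_succ_apply']
      exact Set.compl_subset_compl.2 (shiftD_sub (hlow J)))
    refine key J D hD (subset_antisymm (shiftD_sub (hlow J)) ?_)
    have := Set.compl_subset_compl.1 (hJ (J + 1))
    rwa [Function.iterate_succ_apply'] at this

section Gen
set_option linter.unusedSectionVars false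
variable {M : Type*} [AddCommMonoid M] [PartialOrder M] [WellQuasiOrderedLE M]
  [IsOrderedCancelAddMonoid M] [CanonicallyOrderedAdd M]

theorem poly_step {K : Type*} [Finite K] (f : K → M →+ ℤ) (c : K → ℤ) (P : M → Prop) :
    ∃ B : Set M, B.Finite ∧ (∀ b ∈ B, (∀ k, f k b ≤ c k) ∧ P b) ∧
      ∀ z, (∀ k, f k z ≤ c k) → P z → ∃ b ∈ B, ∃ m, (∀ k, f k m ≤ 0) ∧ z = b + m := by
  obtain ⟨B, hB, hBs, h⟩ := dickson (fun z : M => (z, fun k => (c k - f k z).toNat))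
    {z | (∀ k, f k z ≤ c k) ∧ P z}
  refine ⟨B, hB, fun b hb => hBs hb, fun z hz hP => ?_⟩
  obtain ⟨b, hb, hbz⟩ := h z ⟨hz, hP⟩
  obtain ⟨h1, h2⟩ := Prod.mk_le_mk.1 hbz
  obtain ⟨m, rfl⟩ := exists_add_of_le h1
  refine ⟨b, hb, m, fun k => ?_, rfl⟩
  have h3 := h2 k
  have h4 := (hBs hb).1 k
  have h5 := hz k
  simp only [map_add] at h3 h5
  omega

theorem poly_gen {K : Type*} [Finite K] (f : K → M →+ ℤ) (c : K → ℤ) :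
    ∃ B G : Set M, B.Finite ∧ G.Finite ∧ (∀ b ∈ B, ∀ k, f k b ≤ c k) ∧
      (∀ g ∈ G, g ≠ 0 ∧ ∀ k, f k g ≤ 0) ∧
      ∀ z, (∀ k, f k z ≤ c k) → ∃ b ∈ B, ∃ m ∈ AddSubmonoid.closure G, z = b + m := by
  obtain ⟨B, hB, hB', h⟩ := poly_step f c (fun _ => True)
  obtain ⟨G, hG, hG', h'⟩ := poly_step f (fun _ => 0) (fun z => z ≠ 0)
  refine ⟨B, G, hB, hG, fun b hb => (hB' b hb).1, fun g hg => ⟨(hG' g hg).2, (hG' g hg).1⟩,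
    fun z hz => ?_⟩
  obtain ⟨b, hb, m, hm, rfl⟩ := h z hz trivial
  refine ⟨b, hb, m, ?_, rfl⟩
  clear hz hb
  induction m using WellQuasiOrderedLE.to_wellFoundedLT.induction (α := M) with
  | ind m ih =>
    by_cases h0 : m = 0
    · rw [h0]; exact zero_mem _
    obtain ⟨g, hg, m', hm', rfl⟩ := h' m hm h0
    refine add_mem (AddSubmonoid.subset_closure hg) (ih m' ?_ hm')
    exact lt_add_of_pos_left m' (pos_iff_ne_zero.2 (hG' g hg).2)

end Gen

theorem mem_closure_range {M : Type*} [AddCommMonoid M] {k : ℕ} (g : Fin k → M) (m : M)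
    (hm : m ∈ AddSubmonoid.closure (Set.range g)) : ∃ l : Fin k → ℕ, m = ∑ j, l j • g j := by
  classical
  induction hm using AddSubmonoid.closure_induction with
  | mem x hx =>
    obtain ⟨j, rfl⟩ := hx
    exact ⟨Pi.single j 1, by simp [Pi.single_apply]⟩
  | zero => exact ⟨0, by simp⟩
  | add x y _ _ hx hy =>
    obtain ⟨a, rfl⟩ := hx
    obtain ⟨b, rfl⟩ := hy
    exact ⟨a + b, by simp [add_smul, Finset.sum_add_distrib]⟩

theorem finite_eq_range {α : Type*} {s : Set α} (hs : s.Finite) :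
    ∃ (n : ℕ) (f : Fin n → α), s = Set.range f := by
  have : Finite s := hs
  obtain ⟨n, ⟨e⟩⟩ := Finite.exists_equiv_fin s
  refine ⟨n, fun i => (e.symm i).1, ?_⟩
  ext x
  constructor
  · intro hx
    exact ⟨e ⟨x, hx⟩, by simp⟩
  · rintro ⟨i, rfl⟩
    exact (e.symm i).2

theorem poly_count {V : Type*} [Fintype V] {K : Type*} [Finite K]
    (f : K → (ℕ × (V → ℕ)) →+ ℤ) (c : K → ℤ)
    (hbd : ∀ m : ℕ × (V → ℕ), (∀ k, f k m ≤ 0) → m.1 = 0 → m = 0) :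
    QP (fun t => (({y | ∀ k, f k (t, y) ≤ c k} : Set (V → ℕ)).ncard : ℚ)) := by
  obtain ⟨B, G, hB, hG, hB', hG', h⟩ := poly_gen f c
  obtain ⟨l, b, rfl⟩ := finite_eq_range hB
  obtain ⟨k, g, rfl⟩ := finite_eq_range hG
  let w : Fin k → ℕ := fun j => (g j).1
  have hw : ∀ j, 0 < w j := by
    intro j
    have h1 := hG' (g j) ⟨j, rfl⟩
    rw [Nat.pos_iff_ne_zero]
    intro h0
    exact h1.1 (hbd _ h1.2 h0)
  let rep : Fin l → (Fin k → ℕ) → ℕ × (V → ℕ) := fun i x => b i + ∑ j, x j • g j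
  have hrep : ∀ i x y, rep i (x + y) = rep i x + ∑ j, y j • g j := by
    intro i x y
    simp only [rep, Pi.add_apply, add_smul, Finset.sum_add_distrib, add_assoc]
  have hrep1 : ∀ i x, (rep i x).1 = ∑ j, w j * x j + (b i).1 := by
    intro i x
    simp only [rep, Prod.fst_add, Prod.fst_sum, Prod.smul_fst, smul_eq_mul, w]
    rw [add_comm]
    simp only [mul_comm]
  have hrepQ : ∀ i x κ, f κ (rep i x) ≤ c κ := by
    intro i x κ
    simp only [rep, map_add, map_sum, map_nsmul]
    have h1 := hB' (b i) ⟨i, rfl⟩ κ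
    have h2 : ∑ j, x j • f κ (g j) ≤ 0 :=
      Finset.sum_nonpos fun j _ => nsmul_nonpos ((hG' (g j) ⟨j, rfl⟩).2 κ) _
    linarith
  let code : Fin l → (Fin k → ℕ) → Lex (Fin (k + 1) → ℕ) :=
    fun i x => toLex (Fin.cons (i : ℕ) x)
  have hcode : ∀ i x y, code i (x + y) = code i x + toLex (Fin.cons 0 y) := by
    intro i x y
    change toLex _ = toLex _ + toLex _
    rw [← toLex_add]
    congr 1
    funext j
    refine Fin.cases ?_ (fun j => ?_) j
    · simp
    · simp
  have hcodeinj : ∀ i x i' x', code i x = code i' x' → i = i' ∧ x = x' := by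
    intro i x i' x' h
    have h := toLex.injective h
    have h0 := congrFun h 0
    simp only [Fin.cons_zero] at h0
    refine ⟨Fin.ext h0, ?_⟩
    funext j
    simpa using congrFun h j.succ
  let D : Fin l → Set (Fin k → ℕ) := fun i =>
    {x | ∀ i' x', rep i' x' = rep i x → code i x ≤ code i' x'}
  have hD : ∀ i, IsLowerSet (D i) := by
    intro i x y hyx hx i' x' hx'
    obtain ⟨δ, rfl⟩ := exists_add_of_le hyx
    have := hx i' (x' + δ) (by rw [hrep, hrep, hx'])
    rw [hcode, hcode] at this
    exact le_of_add_le_add_right this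
  let T : ℕ → Fin l → Set (V → ℕ) := fun t i =>
    (fun x => (rep i x).2) '' {x | x ∈ D i ∧ ∑ j, w j * x j + (b i).1 = t}
  have hfin : ∀ t i, ({x | x ∈ D i ∧ ∑ j, w j * x j + (b i).1 = t} : Set (Fin k → ℕ)).Finite := by
    intro t i
    refine (wfin w hw (D i) (t - (b i).1)).subset ?_
    rintro x ⟨hx, hxt⟩
    exact ⟨hx, by omega⟩
  have hTfin : ∀ t i, (T t i).Finite := fun t i => (hfin t i).image _
  have huniq : ∀ t i x i' x', x ∈ D i → ∑ j, w j * x j + (b i).1 = t →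
      x' ∈ D i' → ∑ j, w j * x' j + (b i').1 = t → (rep i x).2 = (rep i' x').2 →
      i = i' ∧ x = x' := by
    intro t i x i' x' hx hxt hx' hxt' he
    have he' : rep i x = rep i' x' := Prod.ext (by rw [hrep1, hrep1, hxt, hxt']) he
    exact hcodeinj _ _ _ _ (le_antisymm (hx _ _ he'.symm) (hx' _ _ he'))
  have hcard : ∀ t, (({y | ∀ k, f k (t, y) ≤ c k} : Set (V → ℕ)).ncard : ℚ) =
      ∑ i, (({x | x ∈ D i ∧ ∑ j, w j * x j + (b i).1 = t} : Set (Fin k → ℕ)).ncard : ℚ) := by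
    intro t
    have h1 : ({y | ∀ k, f k (t, y) ≤ c k} : Set (V → ℕ)) = ⋃ i, T t i := by
      ext y
      simp only [Set.mem_ofPred_eq, Set.mem_iUnion]
      constructor
      · intro hy
        obtain ⟨_, ⟨i₀, rfl⟩, m, hm, hz⟩ := h (t, y) hy
        obtain ⟨x₀, rfl⟩ := mem_closure_range g m hm
        let A : Set (Lex (Fin (k + 1) → ℕ)) := {u | ∃ i x, u = code i x ∧ rep i x = (t, y)}
        have hA : A.Nonempty := ⟨_, i₀, x₀, rfl, hz.symm⟩
        have hwf : WellFounded ((· < ·) : Lex (Fin (k + 1) → ℕ) → _ → Prop) := wellFounded_lt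
        obtain ⟨i, x, hix, hxr⟩ := hwf.min_mem A hA
        refine ⟨i, x, ⟨?_, ?_⟩, ?_⟩
        · intro i' x' hx'
          rw [← hix]
          exact not_lt.1 (hwf.not_lt_min A ⟨i', x', rfl, hx'.trans hxr⟩)
        · rw [← hrep1, hxr]
        · simp only [hxr]
      · rintro ⟨i, x, ⟨hx, hxt⟩, rfl⟩ κ
        have : (t, (rep i x).2) = rep i x := Prod.ext (by rw [hrep1, hxt]) rfl
        simp only [this]
        exact hrepQ i x κ
    rw [h1, Set.ncard_iUnion_of_finite (hTfin t), finsum_eq_sum_of_fintype, Nat.cast_sum]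
    · refine Finset.sum_congr rfl fun i _ => ?_
      congr 1
      apply Set.InjOn.ncard_image
      rintro x ⟨hx, hxt⟩ x' ⟨hx', hxt'⟩ he
      exact (huniq t i x i x' hx hxt hx' hxt' he).2
    · intro i i' hii'
      rw [Function.onFun, Set.disjoint_left]
      rintro _ ⟨x, ⟨hx, hxt⟩, rfl⟩ ⟨x', ⟨hx', hxt'⟩, he⟩
      exact hii' (huniq t i' x' i x hx' hxt' hx hxt he).1.symm
  simp only [hcard]
  refine QP.sum _ fun i _ => ?_
  apply QP.unshift (b i).1
  simp only [Nat.add_right_cancel_iff]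
  exact wcount_qp k w hw (D i) (hD i)

/-- The Boolean algebra of sets generated by half-spaces. -/
inductive HB {M : Type} [AddCommMonoid M] : Set M → Prop
  | half (f : M →+ ℤ) (c : ℤ) : HB {z | f z ≤ c}
  | compl {S : Set M} : HB S → HB Sᶜ
  | inter {S T : Set M} : HB S → HB T → HB (S ∩ T)

namespace HB
variable {M : Type} [AddCommMonoid M]

theorem union {S T : Set M} (hS : HB S) (hT : HB T) : HB (S ∪ T) := by
  have := (hS.compl.inter hT.compl).compl
  rwa [Set.compl_inter, compl_compl, compl_compl] at this

theorem univ : HB (Set.univ : Set M) := by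
  have := HB.half (0 : M →+ ℤ) 0
  simpa using this

theorem empty : HB (∅ : Set M) := by
  simpa using (univ (M := M)).compl

theorem biUnion {α : Type*} (s : Finset α) {S : α → Set M} (h : ∀ a, HB (S a)) :
    HB (⋃ a ∈ s, S a) := by
  classical
  induction s using Finset.induction_on with
  | empty => simpa using empty
  | insert a s ha ih =>
    rw [Finset.set_biUnion_insert]
    exact (h a).union ih

theorem biInter {α : Type*} (s : Finset α) {S : α → Set M} (h : ∀ a, HB (S a)) :
    HB (⋂ a ∈ s, S a) := by
  classical
  induction s using Finset.induction_on with
  | empty => simpa using univ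
  | insert a s ha ih =>
    rw [Finset.set_biInter_insert]
    exact (h a).inter ih

theorem semilinear [AddMonoid.FG M] {S : Set M} (h : HB S) : IsSemilinearSet S := by
  induction h with
  | half f c =>
    have h1 : IsSemilinearSet (Set.Iic c) := by
      apply IsLinearSet.isSemilinearSet
      refine ⟨c, {-1}, Set.finite_singleton _, ?_⟩
      ext x
      simp only [Set.mem_Iic, Set.mem_vadd_set, SetLike.mem_coe, AddSubmonoid.mem_closure_singleton,
        vadd_eq_add]
      constructor
      · intro hx
        refine ⟨x - c, ⟨(c - x).toNat, ?_⟩, by ring⟩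
        simp only [smul_neg, nsmul_eq_mul, mul_one]
        omega
      · rintro ⟨_, ⟨n, rfl⟩, rfl⟩
        simp
    exact h1.preimage f
  | compl _ ih => exact ih.compl
  | inter _ _ ih1 ih2 => exact ih1.inter ih2

open Classical in
theorem indicator_mem {S : Set M} (h : HB S) :
    (fun z => if z ∈ S then (1 : ℤ) else 0) ∈ Algebra.adjoin ℤ
      {φ : M → ℤ | ∃ (f : M →+ ℤ) (c : ℤ), φ = fun z => if f z ≤ c then (1 : ℤ) else 0} := by
  induction h with
  | half f c => 
    refine Algebra.subset_adjoin ⟨f, c, ?_⟩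
    funext z
    by_cases hz : f z ≤ c
    · rw [if_pos hz, if_pos (show z ∈ {z | f z ≤ c} from hz)]
    · rw [if_neg hz, if_neg (show z ∉ {z | f z ≤ c} from hz)]
  | @compl S _ ih =>
    convert sub_mem (one_mem _) ih using 1
    funext z
    by_cases hz : z ∈ S <;> simp [hz]
  | @inter S T _ _ ih1 ih2 =>
    convert mul_mem ih1 ih2 using 1
    funext z
    by_cases hz : z ∈ S <;> by_cases hz' : z ∈ T <;> simp [hz, hz']

end HB

/-- integer linear form on `ℕ × (V → ℕ)`. -/
def lin {V : Type} [Fintype V] (a : V → ℤ) (a0 : ℤ) : (ℕ × (V → ℕ)) →+ ℤ where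
  toFun z := ∑ v, a v * (z.2 v : ℤ) + a0 * (z.1 : ℤ)
  map_zero' := by simp
  map_add' x y := by
    simp only [Prod.snd_add, Prod.fst_add, Pi.add_apply, Nat.cast_add, mul_add,
      Finset.sum_add_distrib]
    ring

theorem lin_apply {V : Type} [Fintype V] (a : V → ℤ) (a0 : ℤ) (t : ℕ) (y : V → ℕ) :
    lin a a0 (t, y) = ∑ v, a v * (y v : ℤ) + a0 * (t : ℤ) := rfl

open Classical in
theorem closure_poly {M : Type} [AddCommMonoid M] (φ : M → ℤ)
    (h : φ ∈ Submonoid.closure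
      {φ : M → ℤ | ∃ (f : M →+ ℤ) (c : ℤ), φ = fun z => if f z ≤ c then (1 : ℤ) else 0}) :
    ∃ L : List ((M →+ ℤ) × ℤ), φ = fun z => if (∀ p ∈ L, p.1 z ≤ p.2) then (1 : ℤ) else 0 := by
  induction h using Submonoid.closure_induction with
  | mem x hx =>
    obtain ⟨f, c, rfl⟩ := hx
    exact ⟨[(f, c)], by simp⟩
  | one => exact ⟨[], by funext; simp⟩
  | mul x y _ _ hx hy =>
    obtain ⟨L1, rfl⟩ := hx
    obtain ⟨L2, rfl⟩ := hy
    refine ⟨L1 ++ L2, ?_⟩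
    funext z
    by_cases h1 : ∀ p ∈ L1, p.1 z ≤ p.2
    · by_cases h2 : ∀ p ∈ L2, p.1 z ≤ p.2
      · have h3 : ∀ p ∈ L1 ++ L2, p.1 z ≤ p.2 := by
          intro p hp
          rcases List.mem_append.1 hp with hp | hp
          · exact h1 p hp
          · exact h2 p hp
        rw [if_pos h3, Pi.mul_apply, if_pos h1, if_pos h2, one_mul]
      · have h3 : ¬ ∀ p ∈ L1 ++ L2, p.1 z ≤ p.2 :=
          fun h => h2 fun p hp => h p (List.mem_append_right _ hp)
        rw [if_neg h3, Pi.mul_apply, if_neg h2, mul_zero]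
    · have h3 : ¬ ∀ p ∈ L1 ++ L2, p.1 z ≤ p.2 :=
        fun h => h1 fun p hp => h p (List.mem_append_left _ hp)
      rw [if_neg h3, Pi.mul_apply, if_neg h1, zero_mul]

/-- digits box -/
def box (V : Type) [Fintype V] [DecidableEq V] (t : ℕ) : Finset (V → ℕ) :=
  Fintype.piFinset (fun _ : V => Finset.range t)

theorem mem_box {V : Type} [Fintype V] [DecidableEq V] {t : ℕ} {y : V → ℕ} :
    y ∈ box V t ↔ ∀ v, y v < t := by simp [box]

theorem sum_box_eq {V : Type} [Fintype V] [DecidableEq V] (t : ℕ) (P : (V → ℕ) → Prop)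
    [DecidablePred P] :
    ((∑ y ∈ box V t, if P y then (1 : ℤ) else 0 : ℤ) : ℚ) =
      (({y | (∀ v, y v < t) ∧ P y} : Set (V → ℕ)).ncard : ℚ) := by
  have : ({y | (∀ v, y v < t) ∧ P y} : Set (V → ℕ)) = ((box V t).filter P : Finset (V → ℕ)) := by
    ext y
    simp [mem_box]
  rw [this, Set.ncard_coe_finset, Finset.sum_boole]
  simp

open Classical in
theorem poly_sum {V : Type} [Fintype V] (φ : ℕ × (V → ℕ) → ℤ)
    (h : φ ∈ Algebra.adjoin ℤ {φ : ℕ × (V → ℕ) → ℤ | ∃ (f : ℕ × (V → ℕ) →+ ℤ) (c : ℤ),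
      φ = fun z => if f z ≤ c then (1 : ℤ) else 0}) :
    QP (fun t => ((∑ y ∈ box V t, φ (t, y) : ℤ) : ℚ)) := by
  rw [← Subalgebra.mem_toSubmodule, Algebra.adjoin_eq_span] at h
  induction h using Submodule.span_induction with
  | mem x hx =>
    obtain ⟨L, rfl⟩ := closure_poly x hx
    have hfin : Finite {p // p ∈ L} := List.finite_toSet L
    have := poly_count (V := V) (K := {p // p ∈ L} ⊕ V)
      (Sum.elim (fun p => p.1.1) (fun v => lin (Pi.single v 1) (-1)))
      (Sum.elim (fun p => p.1.2) (fun v => -1)) (by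
        intro m hm h0
        refine Prod.ext h0 ?_
        funext v
        have := hm (Sum.inr v)
        obtain ⟨t, y⟩ := m
        simp only [Sum.elim_inr, lin_apply, Pi.single_apply] at this
        simp at this h0 ⊢
        omega)
    refine this.congr_eventually 0 fun t _ => ?_
    rw [sum_box_eq t (fun y => ∀ p ∈ L, p.1 (t, y) ≤ p.2)]
    congr 2
    ext y
    simp only [Set.mem_ofPred_eq]
    constructor
    · intro h
      refine ⟨fun v => ?_, fun p hp => h (Sum.inl ⟨p, hp⟩)⟩
      have := h (Sum.inr v)
      simp only [Sum.elim_inr, lin_apply, Pi.single_apply] at this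
      simp at this
      omega
    · rintro ⟨h1, h2⟩ (p | v)
      · exact h2 p.1 p.2
      · have := h1 v
        simp only [Sum.elim_inr, lin_apply, Pi.single_apply]
        simp
        omega
  | zero => simpa using QP.const 0
  | add x y _ _ hx hy =>
    simpa [Finset.sum_add_distrib] using hx.add hy
  | smul a x _ hx =>
    have := (QP.const (a : ℚ)).mul hx
    simpa [Finset.mul_sum] using this

theorem HB.count {V : Type} [Fintype V] {S : Set (ℕ × (V → ℕ))} (hS : HB S) :
    QP (fun t => (({y | (∀ v, y v < t) ∧ (t, y) ∈ S} : Set (V → ℕ)).ncard : ℚ)) := by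
  classical
  have := poly_sum _ hS.indicator_mem
  refine this.congr_eventually 0 fun t _ => ?_
  rw [sum_box_eq t (fun y => (t, y) ∈ S)]

theorem HB.half_le {V : Type} [Fintype V] (a : V → ℤ) (a0 c : ℤ) :
    HB {z : ℕ × (V → ℕ) | ∑ v, a v * (z.2 v : ℤ) + a0 * (z.1 : ℤ) ≤ c} :=
  HB.half (lin a a0) c

theorem key_lemma {V : Type} [Fintype V] (r : ℕ) : ∀ (p : V → Polynomial ℤ) (p0 : Polynomial ℤ),
    (∀ v, (p v).natDegree ≤ r) → p0.natDegree ≤ r →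
    ∃ S : Set (ℕ × (V → ℕ)), HB S ∧ ∀ t y, 0 < t → (∀ v, y v < t) →
      ((t, y) ∈ S ↔ ∑ v, (p v).eval (t : ℤ) * (y v : ℤ) ≤ p0.eval (t : ℤ)) := by
  induction r with
  | zero =>
    intro p p0 hp hp0
    refine ⟨_, HB.half_le (fun v => (p v).coeff 0) 0 (p0.coeff 0), fun t y _ _ => ?_⟩
    have h1 : ∀ v, (p v).eval (t : ℤ) = (p v).coeff 0 := fun v => by
      conv_lhs => rw [Polynomial.eq_C_of_natDegree_le_zero (hp v)]
      simp
    have h0 : p0.eval (t : ℤ) = p0.coeff 0 := by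
      conv_lhs => rw [Polynomial.eq_C_of_natDegree_le_zero hp0]
      simp
    simp only [Set.mem_ofPred_eq, h1, h0, zero_mul, add_zero]
  | succ r ih =>
    intro p p0 hp hp0
    set a : V → ℤ := fun v => (p v).coeff 0 with ha
    set a0 : ℤ := p0.coeff 0 with ha0
    have hIH : ∀ q : ℤ, ∃ S : Set (ℕ × (V → ℕ)), HB S ∧ ∀ t y, 0 < t → (∀ v, y v < t) →
      ((t, y) ∈ S ↔ ∑ v, (p v).divX.eval (t : ℤ) * (y v : ℤ) ≤ (p0.divX - Polynomial.C q).eval (t : ℤ)) := by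
      intro q
      apply ih
      · intro v
        rw [Polynomial.natDegree_divX_eq_natDegree_tsub_one]
        have := hp v
        omega
      · rw [Polynomial.natDegree_sub_C]
        rw [Polynomial.natDegree_divX_eq_natDegree_tsub_one]
        omega
    choose S hS hS' using hIH
    set C : ℤ := ∑ v, |a v| + |a0| + 1 with hC
    refine ⟨⋃ q ∈ Finset.Icc (-C) C,
      ({z | ∑ v, a v * (z.2 v : ℤ) + (-q) * (z.1 : ℤ) ≤ a0} ∩
       {z | ∑ v, a v * (z.2 v : ℤ) + (-(q - 1)) * (z.1 : ℤ) ≤ a0}ᶜ) ∩ S q,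
      HB.biUnion _ fun q => ((HB.half_le _ _ _).inter (HB.half_le _ _ _).compl).inter (hS q), ?_⟩
    intro t y ht hy
    have ev : ∀ (f : Polynomial ℤ), f.eval (t : ℤ) = f.divX.eval (t : ℤ) * t + f.coeff 0 := by
      intro f
      conv_lhs => rw [← Polynomial.divX_mul_X_add f]
      simp
    have hsum : ∑ v, (p v).eval (t : ℤ) * (y v : ℤ) =
        (∑ v, (p v).divX.eval (t : ℤ) * (y v : ℤ)) * t + ∑ v, a v * (y v : ℤ) := by
      rw [Finset.sum_mul, ← Finset.sum_add_distrib]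
      refine Finset.sum_congr rfl fun v _ => ?_
      rw [ev (p v)]
      ring
    rw [hsum, ev p0]
    set S1 := ∑ v, (p v).divX.eval (t : ℤ) * (y v : ℤ)
    set L0 := ∑ v, a v * (y v : ℤ) with hL0
    set E0 := p0.divX.eval (t : ℤ) with hE0
    have ht' : (0 : ℤ) < t := by exact_mod_cast ht
    have hb : |L0 - a0| ≤ (C - 1) * t := by
      have h1 : |L0| ≤ (∑ v, |a v|) * t := by
        rw [Finset.sum_mul]
        refine (Finset.abs_sum_le_sum_abs _ _).trans (Finset.sum_le_sum fun v _ => ?_)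
        rw [abs_mul]
        refine mul_le_mul_of_nonneg_left ?_ (abs_nonneg _)
        rw [abs_of_nonneg (by positivity)]
        exact_mod_cast (hy v).le
      have h2 : |a0| ≤ |a0| * t := le_mul_of_one_le_right (abs_nonneg _) (by omega)
      calc |L0 - a0| ≤ |L0| + |a0| := abs_sub _ _
        _ ≤ (C - 1) * t := by rw [hC]; nlinarith
    rw [abs_le] at hb
    simp only [Set.mem_iUnion, Set.mem_inter_iff, Set.mem_compl_iff, Set.mem_ofPred_eq,
      Finset.mem_Icc]
    have hiff : ∀ q : ℤ, L0 + (-q) * t ≤ a0 → ¬ (L0 + (-(q - 1)) * t ≤ a0) →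
        ((t, y) ∈ S q ↔ S1 * t + L0 ≤ E0 * t + a0) := by
      intro q h1 h2
      rw [hS' q t y ht hy]
      simp only [Polynomial.eval_sub, Polynomial.eval_C]
      change S1 ≤ E0 - q ↔ _
      constructor
      · intro h
        nlinarith
      · intro h
        by_contra hc
        have : E0 - q + 1 ≤ S1 := by omega
        nlinarith
    constructor
    · rintro ⟨q, _, ⟨h1, h2⟩, h3⟩
      exact (hiff q h1 h2).1 h3
    · intro h
      obtain ⟨q, h1, h2⟩ : ∃ q : ℤ, L0 + (-q) * t ≤ a0 ∧ ¬ (L0 + (-(q - 1)) * t ≤ a0) := by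
        refine ⟨-((a0 - L0) / t), ?_, ?_⟩
        · have := Int.ediv_mul_le (a0 - L0) ht'.ne'
          linarith
        · have := Int.lt_ediv_add_one_mul_self (a0 - L0) ht'
          nlinarith
      refine ⟨q, ⟨?_, ?_⟩, ⟨h1, h2⟩, (hiff q h1 h2).2 h⟩
      · by_contra hc
        have : q + 1 ≤ -C := by omega
        nlinarith
      · by_contra hc
        have : C + 1 ≤ q := by omega
        nlinarith

theorem key {V : Type} [Fintype V] (p : V → Polynomial ℤ) (p0 : Polynomial ℤ) :
    ∃ S : Set (ℕ × (V → ℕ)), HB S ∧ ∀ t y, 0 < t → (∀ v, y v < t) →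
      ((t, y) ∈ S ↔ ∑ v, (p v).eval (t : ℤ) * (y v : ℤ) ≤ p0.eval (t : ℤ)) := by
  refine key_lemma ((∑ v, (p v).natDegree) + p0.natDegree) p p0 (fun v => ?_) (by omega)
  have := Finset.single_le_sum (f := fun v => (p v).natDegree) (fun _ _ => Nat.zero_le _)
    (Finset.mem_univ v)
  omega

theorem linear_step {V : Type} {L : Set (ℕ × (V → ℕ))} (hL : IsLinearSet L) :
    ∃ D > 0, ∃ B, ∀ t y, B < t → (t, y) ∈ L →
      ∃ w : V → ℕ, ∀ k : ℕ, (t + D * k, y + k • w) ∈ L := by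
  obtain ⟨a, P, hP, rfl⟩ := hL
  by_cases h : ∃ p ∈ P, 0 < p.1
  · obtain ⟨p, hp, hp0⟩ := h
    refine ⟨p.1, hp0, 0, fun t y _ hy => ⟨p.2, fun k => ?_⟩⟩
    rw [Set.mem_vadd_set] at hy ⊢
    obtain ⟨z, hz, hzy⟩ := hy
    refine ⟨z + k • p, add_mem hz (AddSubmonoid.nsmul_mem _ (AddSubmonoid.subset_closure hp) k), ?_⟩
    rw [vadd_eq_add, ← add_assoc, ← vadd_eq_add a z, hzy]
    refine Prod.ext ?_ ?_
    · simp [mul_comm]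
    · simp
  · push Not at h
    refine ⟨1, one_pos, a.1, fun t y ht hy => ?_⟩
    exfalso
    rw [Set.mem_vadd_set] at hy
    obtain ⟨z, hz, hzy⟩ := hy
    have : z.1 = 0 := by
      have hle : AddSubmonoid.closure P ≤ AddMonoidHom.mker (AddMonoidHom.fst ℕ (V → ℕ)) :=
        (AddSubmonoid.closure_le).2 fun x hx => Nat.le_zero.1 (h x hx)
      exact hle hz
    have h2 := congrArg Prod.fst hzy
    simp [this] at h2
    omega

theorem semilinear_step {V : Type} {L : Set (ℕ × (V → ℕ))} (hL : IsSemilinearSet L) :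
    ∃ D > 0, ∃ B, ∀ t y, B < t → (t, y) ∈ L →
      ∃ w : V → ℕ, ∀ k : ℕ, (t + D * k, y + k • w) ∈ L := by
  obtain ⟨S, hS, hlin, rfl⟩ := hL
  induction S, hS using Set.Finite.induction_on with
  | empty => exact ⟨1, one_pos, 0, by simp⟩
  | @insert L S _ _ ih =>
    obtain ⟨D1, hD1, B1, h1⟩ := linear_step (hlin L (Set.mem_insert _ _))
    obtain ⟨D2, hD2, B2, h2⟩ := ih (fun x hx => hlin x (Set.mem_insert_of_mem _ hx))
    refine ⟨D1 * D2, Nat.mul_pos hD1 hD2, max B1 B2, fun t y ht hy => ?_⟩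
    rw [Set.sUnion_insert] at hy ⊢
    rcases hy with hy | hy
    · obtain ⟨w, hw⟩ := h1 t y (lt_of_le_of_lt (le_max_left _ _) ht) hy
      refine ⟨D2 • w, fun k => Or.inl ?_⟩
      have := hw (D2 * k)
      rwa [← mul_assoc, mul_comm D2 k, mul_smul] at this
    · obtain ⟨w, hw⟩ := h2 t y (lt_of_le_of_lt (le_max_right _ _) ht) hy
      refine ⟨D1 • w, fun k => Or.inr ?_⟩
      have := hw (D1 * k)
      rwa [← mul_assoc, mul_comm D1 k, mul_smul, mul_comm D2 D1] at this

/-! ### Peeling -/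

/-- Remove the maximum. -/
def peelF {α : Type} (o : α → ℤ) (F : Set α) : Set α := {y ∈ F | ∃ y' ∈ F, o y < o y'}

theorem peelF_iter {α : Type} (o : α → ℤ) (F : Set α) (hF : F.Finite) (hinj : Set.InjOn o F)
    (k : ℕ) : ((peelF o)^[k] F ⊆ F) ∧ ((peelF o)^[k] F).ncard = F.ncard - k ∧
      ∀ y ∈ F, y ∉ (peelF o)^[k] F → ∀ y' ∈ (peelF o)^[k] F, o y' < o y := by
  induction k with
  | zero => exact ⟨le_rfl, by simp, fun y h1 h2 => absurd h1 h2⟩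
  | succ k ih =>
    rw [Function.iterate_succ_apply']
    set G := (peelF o)^[k] F with hG
    obtain ⟨h1, h2, h3⟩ := ih
    have hGf : G.Finite := hF.subset h1
    have hsub : peelF o G ⊆ G := fun y hy => hy.1
    refine ⟨hsub.trans h1, ?_, ?_⟩
    · rcases G.eq_empty_or_nonempty with he | hne
      · rw [he] at h2 ⊢
        simp [peelF] at h2 ⊢
        omega
      · obtain ⟨m, hm, hmax⟩ := hGf.exists_maximalFor o G hne
        have : peelF o G = G \ {m} := by
          ext y
          simp only [peelF, Set.mem_ofPred_eq, Set.mem_diff, Set.mem_singleton_iff]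
          refine and_congr_right fun hy => ⟨?_, ?_⟩
          · rintro ⟨y', hy', hlt⟩ rfl
            have := hmax hy' hlt.le
            omega
          · intro hne
            refine ⟨m, hm, ?_⟩
            by_contra hc
            have h5 := hmax hy (not_lt.1 hc)
            exact hne (hinj (h1 hy) (h1 hm) (le_antisymm h5 (not_lt.1 hc)))
        rw [this, Set.ncard_diff_singleton_of_mem hm, h2]
        omega
    · intro y hy hny y' hy'
      by_cases hyG : y ∈ G
      · have h4 : ∀ z ∈ G, o z ≤ o y := by
          intro z hz
          by_contra hc
          exact hny ⟨hyG, z, hz, not_le.1 hc⟩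
        obtain ⟨h5, z, hz, hlt⟩ := hy'
        exact lt_of_lt_of_le hlt (h4 z hz)
      · exact h3 y hy hyG y' hy'.1

theorem peelF_kth {α : Type} (o c : α → ℤ) (F : Set α) (hF : F.Finite) (hinj : Set.InjOn o F)
    (href : ∀ a ∈ F, ∀ b ∈ F, c a < c b → o a < o b) (k : ℕ) (m : α)
    (hm : m ∈ (peelF o)^[k] F) (hm' : m ∉ (peelF o)^[k + 1] F) :
    IsKthLargest F c (k + 1) ((c m : ℤ) : WithBot ℤ) := by
  obtain ⟨h1, h2, h3⟩ := peelF_iter o F hF hinj k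
  obtain ⟨g1, g2, g3⟩ := peelF_iter o F hF hinj (k + 1)
  have hpos : 0 < ((peelF o)^[k] F).ncard :=
    (Set.ncard_pos (hF.subset h1)).2 ⟨m, hm⟩
  have hmax : ∀ z ∈ (peelF o)^[k] F, o z ≤ o m := by
    intro z hz
    by_contra hc
    apply hm'
    rw [Function.iterate_succ_apply']
    exact ⟨hm, z, hz, not_le.1 hc⟩
  refine Or.inr ⟨by omega, c m, rfl, ?_, ?_⟩
  · have : {x ∈ F | c m < c x} ⊆ F \ (peelF o)^[k] F := by
      rintro x ⟨hx, hlt⟩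
      refine ⟨hx, fun hx' => ?_⟩
      have := href m (h1 hm) x hx hlt
      have := hmax x hx'
      omega
    have h5 := Set.ncard_le_ncard this (hF.subset Set.diff_subset)
    rw [Set.ncard_diff h1 (hF.subset h1)] at h5
    omega
  · have : F \ (peelF o)^[k + 1] F ⊆ {x ∈ F | c m ≤ c x} := by
      rintro x ⟨hx, hnx⟩
      refine ⟨hx, ?_⟩
      by_contra hc
      have hlt := href x hx m (h1 hm) (not_le.1 hc)
      by_cases hxk : x ∈ (peelF o)^[k] F
      · apply hnx
        rw [Function.iterate_succ_apply']
        exact ⟨hxk, m, hm, hlt⟩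
      · have := h3 x hx hxk m hm
        omega
    have h5 := Set.ncard_le_ncard this (hF.subset (Set.sep_subset _ _))
    rw [Set.ncard_diff g1 (hF.subset g1)] at h5
    omega

theorem kth_unique {α : Type} {F : Set α} {c : α → ℤ} {ℓ : ℕ} (hℓ : 0 < ℓ) {v w : WithBot ℤ}
    (hv : IsKthLargest F c ℓ v) (hw : IsKthLargest F c ℓ w) : v = w := by
  have aux : ∀ z z' : ℤ, ℓ ≤ F.ncard → {x ∈ F | z < c x}.ncard < ℓ → ℓ ≤ {x ∈ F | z' ≤ c x}.ncard →
      z' ≤ z := by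
    intro z z' h0 h1 h2
    by_contra hc
    have hF : F.Finite := Set.finite_of_ncard_pos (by omega)
    have : {x ∈ F | z' ≤ c x} ⊆ {x ∈ F | z < c x} := fun x hx => ⟨hx.1, by have := hx.2; omega⟩
    have := Set.ncard_le_ncard this (hF.subset (Set.sep_subset _ _))
    omega
  rcases hv with ⟨h1, rfl⟩ | ⟨h1, z, rfl, h2, h3⟩ <;> rcases hw with ⟨g1, rfl⟩ | ⟨g1, z', rfl, g2, g3⟩
  · rfl
  · omega
  · omega
  · rw [le_antisymm (aux z' z h1 g2 h3) (aux z z' h1 h2 g3)]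

theorem kth_image {α β : Type} {F : Set α} (φ : α → β) (hφ : Set.InjOn φ F) (c : β → ℤ) (ℓ : ℕ)
    (v : WithBot ℤ) (h : IsKthLargest (φ '' F) c ℓ v) : IsKthLargest F (fun a => c (φ a)) ℓ v := by
  have key : ∀ P : ℤ → Prop, {x ∈ φ '' F | P (c x)}.ncard = {x ∈ F | P (c (φ x))}.ncard := by
    intro P
    have : {x ∈ φ '' F | P (c x)} = φ '' {x ∈ F | P (c (φ x))} := by
      ext x
      constructor
      · rintro ⟨⟨a, ha, rfl⟩, hx⟩
        exact ⟨a, ⟨ha, hx⟩, rfl⟩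
      · rintro ⟨a, ⟨ha, hx⟩, rfl⟩
        exact ⟨⟨a, ha, rfl⟩, hx⟩
    rw [this, Set.InjOn.ncard_image (hφ.mono (Set.sep_subset _ _))]
  rcases h with ⟨h1, rfl⟩ | ⟨h1, z, rfl, h2, h3⟩
  · rw [Set.InjOn.ncard_image hφ] at h1
    exact Or.inl ⟨h1, rfl⟩
  · rw [Set.InjOn.ncard_image hφ] at h1
    rw [key (fun a => z < a)] at h2
    rw [key (fun a => z ≤ a)] at h3
    exact Or.inr ⟨h1, z, rfl, h2, h3⟩

/-- restriction of coordinates as an additive hom -/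
def resHom {V W : Type} (e : W → V) : (ℕ × (V → ℕ)) →+ (ℕ × (W → ℕ)) where
  toFun z := (z.1, fun w => z.2 (e w))
  map_zero' := rfl
  map_add' _ _ := rfl

/-- Fibrewise peeling. -/
def peelS {V : Type} (o : ℕ → (V → ℕ) → ℤ) (S : Set (ℕ × (V → ℕ))) : Set (ℕ × (V → ℕ)) :=
  {z | z ∈ S ∧ ∃ y', (z.1, y') ∈ S ∧ o z.1 z.2 < o z.1 y'}

theorem peelS_fibre {V : Type} (o : ℕ → (V → ℕ) → ℤ) (S : Set (ℕ × (V → ℕ))) (t : ℕ) (k : ℕ) :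
    {y | (t, y) ∈ (peelS o)^[k] S} = (peelF (o t))^[k] {y | (t, y) ∈ S} := by
  induction k with
  | zero => rfl
  | succ k ih =>
    rw [Function.iterate_succ_apply', Function.iterate_succ_apply', ← ih]
    rfl

theorem peelS_semilinear {V : Type} [Fintype V] (P : V → Polynomial ℤ) (S : Set (ℕ × (V → ℕ)))
    (hS : IsSemilinearSet S) (hbox : ∀ t y, (t, y) ∈ S → 0 < t ∧ ∀ v, y v < t) :
    IsSemilinearSet (peelS (fun t y => ∑ v, (P v).eval (t : ℤ) * (y v : ℤ)) S) := by
  obtain ⟨T, hT, hT'⟩ := key (V := V ⊕ V) (Sum.elim P (fun v => -P v)) (-1)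
  have h1 : IsSemilinearSet ((resHom (Sum.inl : V → V ⊕ V)) ⁻¹' S) := hS.preimage _
  have h2 : IsSemilinearSet ((resHom (Sum.inr : V → V ⊕ V)) ⁻¹' S) := hS.preimage _
  have h3 := ((h1.inter h2).inter hT.semilinear).image (resHom (Sum.inl : V → V ⊕ V))
  convert h3 using 1
  have hlt : ∀ t y y', (t, y) ∈ S → (t, y') ∈ S → ((t, Sum.elim y y') ∈ T ↔
      ∑ v, (P v).eval (t : ℤ) * (y v : ℤ) < ∑ v, (P v).eval (t : ℤ) * (y' v : ℤ)) := by
    intro t y y' hy hy'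
    rw [hT' t _ (hbox t y hy).1 (by
      rintro (v | v)
      · exact (hbox t y hy).2 v
      · exact (hbox t y' hy').2 v)]
    simp [Fintype.sum_sum_type]
    omega
  ext ⟨t, y⟩
  constructor
  · rintro ⟨hy, y', hy', hlt'⟩
    exact ⟨(t, Sum.elim y y'), ⟨⟨hy, hy'⟩, (hlt t y y' hy hy').2 hlt'⟩, rfl⟩
  · rintro ⟨⟨t', yy⟩, ⟨⟨h1, h2⟩, h3⟩, heq⟩
    have e1 : t' = t := congrArg Prod.fst heq
    have e2 : (fun w => yy (Sum.inl w)) = y := congrArg Prod.snd heq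
    subst e1 e2
    refine ⟨h1, fun w => yy (Sum.inr w), h2, ?_⟩
    refine (hlt t' _ _ h1 h2).1 ?_
    have : Sum.elim (fun w => yy (Sum.inl w)) (fun w => yy (Sum.inr w)) = yy := by
      funext w
      rcases w with w | w <;> rfl
    rw [this]
    exact h3

theorem peelS_sub {V : Type} (o : ℕ → (V → ℕ) → ℤ) (S : Set (ℕ × (V → ℕ))) (k : ℕ) :
    (peelS o)^[k] S ⊆ S := by
  induction k with
  | zero => exact le_rfl
  | succ k ih =>
    rw [Function.iterate_succ_apply']
    exact fun z hz => ih hz.1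

theorem peelS_iter_semilinear {V : Type} [Fintype V] (P : V → Polynomial ℤ) (S : Set (ℕ × (V → ℕ)))
    (hS : IsSemilinearSet S) (hbox : ∀ t y, (t, y) ∈ S → 0 < t ∧ ∀ v, y v < t) (k : ℕ) :
    IsSemilinearSet ((peelS (fun t y => ∑ v, (P v).eval (t : ℤ) * (y v : ℤ)))^[k] S) := by
  induction k with
  | zero => exact hS
  | succ k ih =>
    rw [Function.iterate_succ_apply']
    exact peelS_semilinear P _ ih fun t y hy => hbox t y (peelS_sub _ S k hy)

/-- value of digits -/
theorem digits_lt {K : ℕ} {V : Type} [Fintype V] (e : V ≃ Fin K) (t : ℕ) (y : V → ℕ)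
    (hy : ∀ v, y v < t) : ∑ v, t ^ (e v : ℕ) * y v < t ^ K := by
  have := (finFunctionFinEquiv (fun i => (⟨y (e.symm i), hy _⟩ : Fin t))).2
  rw [finFunctionFinEquiv_apply] at this
  rw [← e.symm.sum_comp]
  simpa [mul_comm] using this

theorem digits_inj {K : ℕ} {V : Type} [Fintype V] (e : V ≃ Fin K) (t : ℕ) (y y' : V → ℕ)
    (hy : ∀ v, y v < t) (hy' : ∀ v, y' v < t)
    (h : ∑ v, t ^ (e v : ℕ) * y v = ∑ v, t ^ (e v : ℕ) * y' v) : y = y' := by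
  have : (fun i => (⟨y (e.symm i), hy _⟩ : Fin t)) = fun i => (⟨y' (e.symm i), hy' _⟩ : Fin t) := by
    apply finFunctionFinEquiv.injective
    ext
    rw [finFunctionFinEquiv_apply, finFunctionFinEquiv_apply]
    rw [← e.symm.sum_comp, ← e.symm.sum_comp] at h
    simpa [mul_comm] using h
  funext v
  have := congrArg Fin.val (congrFun this (e v))
  simpa using this

theorem kth_main {V : Type} [Fintype V] (S : Set (ℕ × (V → ℕ))) (hS : IsSemilinearSet S)
    (hbox : ∀ t y, (t, y) ∈ S → 0 < t ∧ ∀ v, y v < t) (q : V → Polynomial ℤ) (q0 : Polynomial ℤ)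
    (ℓ : ℕ) (hℓ : 0 < ℓ) (f : ℕ → WithBot ℤ) (N0 : ℕ)
    (hf : ∀ t, N0 ≤ t → IsKthLargest {y | (t, y) ∈ S}
      (fun y => ∑ v, (q v).eval (t : ℤ) * (y v : ℤ) + q0.eval (t : ℤ)) ℓ (f t)) :
    IsEQPBot f := by
  classical
  set K := Fintype.card V with hK
  set e : V ≃ Fin K := Fintype.equivFin V
  set P : V → Polynomial ℤ := fun v => Polynomial.X ^ K * q v + Polynomial.X ^ (e v : ℕ) with hP
  set o : ℕ → (V → ℕ) → ℤ := fun t y => ∑ v, (P v).eval (t : ℤ) * (y v : ℤ) with ho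
  set c : ℕ → (V → ℕ) → ℤ := fun t y => ∑ v, (q v).eval (t : ℤ) * (y v : ℤ) + q0.eval (t : ℤ) with hc
  have hoc : ∀ t y, o t y = (t : ℤ) ^ K * (c t y - q0.eval (t : ℤ)) +
      ((∑ v, t ^ (e v : ℕ) * y v : ℕ) : ℤ) := by
    intro t y
    simp only [ho, hc, hP, Polynomial.eval_add, Polynomial.eval_mul, Polynomial.eval_pow,
      Polynomial.eval_X, add_mul, Finset.sum_add_distrib, add_sub_cancel_right, Finset.mul_sum,
      mul_assoc]
    push_cast
    rfl
  have href : ∀ t y y', (∀ v, y v < t) → (∀ v, y' v < t) → c t y < c t y' → o t y < o t y' := by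
    intro t y y' hy hy' hlt
    rw [hoc, hoc]
    have h1 := digits_lt e t y hy
    have h2 : ((∑ v, t ^ (e v : ℕ) * y v : ℕ) : ℤ) < (t : ℤ) ^ K := by exact_mod_cast h1
    have h3 : (0 : ℤ) ≤ ((∑ v, t ^ (e v : ℕ) * y' v : ℕ) : ℤ) := by positivity
    have h4 : (0 : ℤ) ≤ (t : ℤ) ^ K := by positivity
    have h5 : (t : ℤ) ^ K * (c t y + 1) ≤ (t : ℤ) ^ K * c t y' :=
      mul_le_mul_of_nonneg_left (by omega) h4
    nlinarith
  have hinj : ∀ t, Set.InjOn (o t) {y | (t, y) ∈ S} := by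
    intro t y hy y' hy' heq
    have b1 := (hbox t y hy).2
    have b2 := (hbox t y' hy').2
    have hceq : c t y = c t y' := by
      rcases lt_trichotomy (c t y) (c t y') with h | h | h
      · have := href t _ _ b1 b2 h
        omega
      · exact h
      · have := href t _ _ b2 b1 h
        omega
    rw [hoc, hoc, hceq] at heq
    exact digits_inj e t y y' b1 b2 (by exact_mod_cast add_left_cancel heq)
  have hfin : ∀ t, {y | (t, y) ∈ S}.Finite := by
    intro t
    refine (box V t).finite_toSet.subset fun y hy => ?_
    exact mem_box.2 (hbox t y hy).2
  obtain ⟨k, rfl⟩ : ∃ k, ℓ = k + 1 := ⟨ℓ - 1, by omega⟩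
  set G : Set (ℕ × (V → ℕ)) := (peelS o)^[k] S \ (peelS o)^[k + 1] S with hG
  have hGs : IsSemilinearSet G :=
    (peelS_iter_semilinear P S hS hbox k).sdiff (peelS_iter_semilinear P S hS hbox (k + 1))
  have hGval : ∀ t y, N0 ≤ t → (t, y) ∈ G → f t = ((c t y : ℤ) : WithBot ℤ) := by
    intro t y ht hy
    have h1 : y ∈ (peelF (o t))^[k] {y | (t, y) ∈ S} := by
      rw [← peelS_fibre]
      exact hy.1
    have h2 : y ∉ (peelF (o t))^[k + 1] {y | (t, y) ∈ S} := by
      rw [← peelS_fibre]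
      exact hy.2
    refine kth_unique hℓ (hf t ht) (peelF_kth (o t) (c t) _ (hfin t) (hinj t) ?_ k y h1 h2)
    intro a ha b hb
    exact href t a b (hbox t a ha).2 (hbox t b hb).2
  have hGex : ∀ t, N0 ≤ t → f t ≠ ⊥ → ∃ y, (t, y) ∈ G := by
    intro t ht hne
    rcases hf t ht with ⟨_, h⟩ | ⟨h1, -⟩
    · exact absurd h hne
    · obtain ⟨-, a2, -⟩ := peelF_iter (o t) _ (hfin t) (hinj t) k
      obtain ⟨b1, b2, -⟩ := peelF_iter (o t) _ (hfin t) (hinj t) (k + 1)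
      rw [← peelS_fibre] at a2 b2 b1
      by_contra hcon
      push Not at hcon
      have hsub : {y | (t, y) ∈ (peelS o)^[k] S} ⊆ {y | (t, y) ∈ (peelS o)^[k + 1] S} := by
        intro y hy
        by_contra hny
        exact hcon y ⟨hy, hny⟩
      have := Set.ncard_le_ncard hsub ((hfin t).subset b1)
      omega
  obtain ⟨D, hD, B, hstep⟩ := semilinear_step hGs
  refine ⟨D, hD, fun r hr => ?_⟩
  by_cases hex : ∃ t y, max B N0 < t ∧ t % D = r ∧ (t, y) ∈ G
  · left
    obtain ⟨t0, y0, ht0, hmod, hy0⟩ := hex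
    obtain ⟨w, hw⟩ := hstep t0 y0 (lt_of_le_of_lt (le_max_left _ _) ht0) hy0
    refine ⟨∑ v, (q v).map (Int.castRingHom ℚ) * (Polynomial.C (y0 v : ℚ) +
      Polynomial.C ((w v : ℚ) / D) * (Polynomial.X - Polynomial.C (t0 : ℚ))) +
      q0.map (Int.castRingHom ℚ), t0, fun t ht hmt => ?_⟩
    obtain ⟨m, rfl⟩ : ∃ m, t = t0 + D * m := by
      have hdvd : D ∣ t - t0 := (Nat.modEq_iff_dvd' ht).1 (by rw [Nat.ModEq, hmod, hmt])
      obtain ⟨m, hm⟩ := hdvd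
      exact ⟨m, by omega⟩
    refine ⟨_, hGval _ _ ?_ (hw m), ?_⟩
    · have := le_max_right B N0
      omega
    · have hev : ∀ (p : Polynomial ℤ) (t : ℕ), (p.map (Int.castRingHom ℚ)).eval (t : ℚ) =
          ((p.eval (t : ℤ) : ℤ) : ℚ) := by
        intro p t
        have := Polynomial.eval_intCast_map (Int.castRingHom ℚ) p (t : ℤ)
        simpa using this
      simp only [hc, Polynomial.eval_add, Polynomial.eval_finset_sum, Polynomial.eval_mul, hev,
        Polynomial.eval_C, Polynomial.eval_sub, Polynomial.eval_X]
      push_cast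
      congr 1
      refine Finset.sum_congr rfl fun v _ => ?_
      congr 1
      have : (D : ℚ) ≠ 0 := by positivity
      simp
      field_simp
  · right
    push Not at hex
    refine ⟨max B N0 + 1, fun t ht hmt => ?_⟩
    by_contra hne
    obtain ⟨y, hy⟩ := hGex t (by have := le_max_right B N0; omega) hne
    exact hex t y (by omega) hmt hy

theorem exists_between_finite {κ : Type} [Fintype κ] (p q : κ → Prop) (U : κ → ℝ)
    (h : ∀ k l, p k → q l → U l ≤ U k) :
    ∃ y, (∀ k, p k → y ≤ U k) ∧ ∀ l, q l → U l ≤ y := by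
  classical
  by_cases hq : ∃ l, q l
  · obtain ⟨l0, hl0⟩ := hq
    obtain ⟨l, hl, hmax⟩ := Finset.exists_max_image (Finset.univ.filter q) U ⟨l0, by simpa using hl0⟩
    simp only [Finset.mem_filter, Finset.mem_univ, true_and] at hl hmax
    exact ⟨U l, fun k hk => h k l hk hl, hmax⟩
  · by_cases hp : ∃ k, p k
    · obtain ⟨l0, hl0⟩ := hp
      obtain ⟨l, hl, hmax⟩ := Finset.exists_min_image (Finset.univ.filter p) U ⟨l0, by simpa using hl0⟩
      simp only [Finset.mem_filter, Finset.mem_univ, true_and] at hl hmax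
      exact ⟨U l, hmax, fun k hk => absurd ⟨k, hk⟩ hq⟩
    · exact ⟨0, fun k hk => absurd ⟨k, hk⟩ hp, fun k hk => absurd ⟨k, hk⟩ hq⟩

theorem fm_bound (n : ℕ) : ∀ s : ℕ, ∃ r : ℕ, ∀ t : ℕ, 2 ≤ t → ∀ (κ : Type) [Fintype κ]
    (a : κ → Fin (n + 1) → ℤ) (b : κ → ℤ), (∀ k j, |a k j| ≤ (t : ℤ) ^ s) →
    (∀ k, |b k| ≤ (t : ℤ) ^ s) →
    (∃ C : ℝ, ∀ x : Fin (n + 1) → ℝ, (∀ k, ∑ j, (a k j : ℝ) * x j ≤ b k) → |x 0| ≤ C) →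
    ∀ x : Fin (n + 1) → ℝ, (∀ k, ∑ j, (a k j : ℝ) * x j ≤ b k) → |x 0| ≤ (t : ℝ) ^ r := by
  induction n with
  | zero =>
    intro s
    refine ⟨s, fun t ht κ _ a b ha hb hC x hx => ?_⟩
    obtain ⟨C, hC⟩ := hC
    have hC0 := hC x hx
    simp only [Fin.sum_univ_succ, Finset.univ_eq_empty, Finset.sum_empty, add_zero] at hC hx
    have hb' : ∀ k, |(b k : ℝ)| ≤ (t : ℝ) ^ s := fun k => by exact_mod_cast hb k
    have hts : (0 : ℝ) ≤ (t : ℝ) ^ s := by positivity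
    rw [abs_le] at hC0 ⊢
    constructor
    · obtain ⟨k, hk⟩ : ∃ k, a k 0 < 0 := by
        by_contra hcon
        push Not at hcon
        have := hC (fun _ => x 0 - (2 * C + 1)) (fun k => by
          have h1 := hx k
          have h2 : (0 : ℝ) ≤ a k 0 := by exact_mod_cast hcon k
          nlinarith)
        rw [abs_le] at this
        linarith
      have h1 := hx k
      have h2 : (a k 0 : ℝ) ≤ -1 := by exact_mod_cast (by omega : a k 0 ≤ -1)
      have h3 := abs_le.1 (hb' k)
      by_contra hc
      push Not at hc
      nlinarith
    · obtain ⟨k, hk⟩ : ∃ k, 0 < a k 0 := by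
        by_contra hcon
        push Not at hcon
        have := hC (fun _ => x 0 + (2 * C + 1)) (fun k => by
          have h1 := hx k
          have h2 : (a k 0 : ℝ) ≤ 0 := by exact_mod_cast hcon k
          nlinarith)
        rw [abs_le] at this
        linarith
      have h1 := hx k
      have h2 : (1 : ℝ) ≤ a k 0 := by exact_mod_cast hk
      have h3 := abs_le.1 (hb' k)
      by_contra hc
      push Not at hc
      nlinarith
  | succ n ih =>
    intro s
    obtain ⟨r, hr⟩ := ih (2 * s + 1)
    refine ⟨r, fun t ht κ _ a b ha hb hC x hx => ?_⟩
    set d : κ → ℤ := fun k => a k (Fin.last (n + 1)) with hd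
    -- generic combination
    set comb : (κ → ℤ) → κ × κ → ℤ := fun g kl =>
      if 0 < d kl.1 ∧ d kl.2 < 0 then d kl.1 * g kl.2 - d kl.2 * g kl.1
      else if d kl.1 = 0 then g kl.1 else 0 with hcomb
    have hH : (1 : ℤ) ≤ (t : ℤ) ^ s := one_le_pow₀ (by omega)
    have hcb : ∀ g : κ → ℤ, (∀ k, |g k| ≤ (t : ℤ) ^ s) → ∀ kl, |comb g kl| ≤ (t : ℤ) ^ (2 * s + 1) := by
      intro g hg kl
      have e1 : (t : ℤ) ^ (2 * s + 1) = (t : ℤ) ^ s * (t : ℤ) ^ s * t := by ring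
      have ht2 : (2 : ℤ) ≤ t := by exact_mod_cast ht
      rw [e1]
      set H := (t : ℤ) ^ s
      have hHH : H ≤ H * H := by nlinarith
      simp only [hcomb]
      split_ifs
      · have h1 : |d kl.1 * g kl.2| ≤ H * H := by
          rw [abs_mul]
          exact mul_le_mul (ha _ _) (hg _) (abs_nonneg _) (by omega)
        have h2 : |d kl.2 * g kl.1| ≤ H * H := by
          rw [abs_mul]
          exact mul_le_mul (ha _ _) (hg _) (abs_nonneg _) (by omega)
        have := abs_sub (d kl.1 * g kl.2) (d kl.2 * g kl.1)
        nlinarith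
      · have := hg kl.1
        nlinarith
      · rw [abs_zero]
        positivity
    have hsnd : ∀ x : Fin (n + 2) → ℝ, (∀ k, ∑ j, (a k j : ℝ) * x j ≤ b k) →
        ∀ kl, ∑ j : Fin (n + 1), (comb (fun k => a k j.castSucc) kl : ℝ) * x j.castSucc ≤ comb b kl := by
      intro x hx kl
      have h1 := hx kl.1
      have h2 := hx kl.2
      rw [Fin.sum_univ_castSucc] at h1 h2
      simp only [hcomb]
      split_ifs with hc hc'
      · have p1 : (0 : ℝ) < d kl.1 := by exact_mod_cast hc.1
        have p2 : (d kl.2 : ℝ) < 0 := by exact_mod_cast hc.2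
        push_cast
        simp only [sub_mul, Finset.sum_sub_distrib, mul_assoc, ← Finset.mul_sum]
        change _ + (d kl.1 : ℝ) * _ ≤ _ at h1
        change _ + (d kl.2 : ℝ) * _ ≤ _ at h2
        have m1 := mul_le_mul_of_nonneg_left h1 (neg_nonneg.2 p2.le)
        have m2 := mul_le_mul_of_nonneg_left h2 p1.le
        linarith
      · change _ + (d kl.1 : ℝ) * _ ≤ _ at h1
        rw [hc'] at h1
        simpa using h1
      · simp
    have hlift : ∀ z : Fin (n + 1) → ℝ,
        (∀ kl, ∑ j : Fin (n + 1), (comb (fun k => a k j.castSucc) kl : ℝ) * z j ≤ comb b kl) →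
        ∃ x : Fin (n + 2) → ℝ, (∀ k, ∑ j, (a k j : ℝ) * x j ≤ b k) ∧ ∀ j : Fin (n + 1), x j.castSucc = z j := by
      intro z hz
      set w : κ → ℝ := fun k => b k - ∑ j : Fin (n + 1), (a k j.castSucc : ℝ) * z j with hw
      obtain ⟨y, hy1, hy2⟩ := exists_between_finite (fun k => 0 < d k) (fun k => d k < 0)
        (fun k => w k / d k) (by
          intro k l hk hl
          have h := hz (k, l)
          have p1 : (0 : ℝ) < d k := by exact_mod_cast hk
          have p2 : (d l : ℝ) < 0 := by exact_mod_cast hl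
          simp only [hcomb, hk, hl, and_self, if_true] at h
          push_cast at h
          simp only [sub_mul, Finset.sum_sub_distrib, mul_assoc, ← Finset.mul_sum] at h
          have h' : (d l : ℝ) * w k ≤ d k * w l := by
            simp only [hw]
            linarith
          rw [le_div_iff₀ p1, div_mul_eq_mul_div, div_le_iff_of_neg p2]
          linarith)
      refine ⟨Fin.snoc z y, fun k => ?_, fun j => by simp⟩
      rw [Fin.sum_univ_castSucc]
      simp only [Fin.snoc_castSucc, Fin.snoc_last]
      change _ + (d k : ℝ) * y ≤ _
      have hgoal : (d k : ℝ) * y ≤ w k := by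
        rcases lt_trichotomy (d k) 0 with hk | hk | hk
        · have p2 : (d k : ℝ) < 0 := by exact_mod_cast hk
          have := hy2 k hk
          rw [div_le_iff_of_neg p2] at this
          linarith
        · have h := hz (k, k)
          simp only [hcomb, hk, lt_irrefl, and_self, if_false, if_true] at h
          rw [hk]
          simp only [hw]
          push_cast
          linarith
        · have p2 : (0 : ℝ) < d k := by exact_mod_cast hk
          have := hy1 k hk
          rw [le_div_iff₀ p2] at this
          linarith
      simp only [hw] at hgoal
      linarith
    have := hr t ht (κ × κ) (fun kl j => comb (fun k => a k j.castSucc) kl) (comb b)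
      (fun kl j => hcb _ (fun k => ha k _) kl) (hcb b hb) (by
        obtain ⟨C, hC⟩ := hC
        refine ⟨C, fun z hz => ?_⟩
        obtain ⟨x, hx, hxz⟩ := hlift z hz
        rw [← hxz 0]
        exact hC x hx) (fun j => x j.castSucc) (hsnd x hx)
    simpa using this

theorem poly_bound (n s : ℕ) : ∃ r : ℕ, ∀ t : ℕ, 2 ≤ t → ∀ (κ : Type) [Fintype κ]
    (a : κ → Fin n → ℤ) (b : κ → ℤ), (∀ k j, |a k j| ≤ (t : ℤ) ^ s) →
    (∀ k, |b k| ≤ (t : ℤ) ^ s) →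
    Bornology.IsBounded {x : Fin n → ℝ | ∀ k, ∑ j, (a k j : ℝ) * x j ≤ b k} →
    ∀ x : Fin n → ℝ, (∀ k, ∑ j, (a k j : ℝ) * x j ≤ b k) → ∀ j, |x j| ≤ (t : ℝ) ^ r := by
  rcases n with _ | n
  · exact ⟨0, fun _ _ _ _ _ _ _ _ _ _ _ j => j.elim0⟩
  obtain ⟨r, hr⟩ := fm_bound n s
  refine ⟨r, fun t ht κ _ a b ha hb hbd x hx j => ?_⟩
  set e := Equiv.swap (0 : Fin (n + 1)) j with he
  have hsum : ∀ k (x : Fin (n + 1) → ℝ), ∑ i, (a k (e i) : ℝ) * x i = ∑ i, (a k i : ℝ) * x (e i) := by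
    intro k x
    rw [← Equiv.sum_comp e (fun i => (a k i : ℝ) * x (e i))]
    simp [he]
  have := hr t ht κ (fun k i => a k (e i)) b (fun k i => ha k _) hb (by
    obtain ⟨C, hC⟩ := hbd.exists_norm_le
    refine ⟨C, fun z hz => ?_⟩
    simp only [hsum] at hz
    have h1 := hC (fun i => z (e i)) hz
    have h2 := norm_le_pi_norm (fun i => z (e i)) j
    simp only [he, Equiv.swap_apply_right, Real.norm_eq_abs] at h1 h2
    exact h2.trans h1) (fun i => x (e i)) (fun k => by
      rw [hsum]
      simpa [he] using hx k)
  simpa [he] using this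

theorem poly_growth (p : Polynomial ℤ) : ∃ s N : ℕ, ∀ t : ℕ, N ≤ t → |p.eval (t : ℤ)| ≤ (t : ℤ) ^ s := by
  set C := ∑ i ∈ p.support, |p.coeff i| with hC
  refine ⟨p.natDegree + 1, C.toNat + 1, fun t ht => ?_⟩
  have hC0 : 0 ≤ C := Finset.sum_nonneg fun _ _ => abs_nonneg _
  have ht1 : (1 : ℤ) ≤ t := by omega
  rw [Polynomial.eval_eq_sum, Polynomial.sum]
  calc |∑ i ∈ p.support, p.coeff i * (t : ℤ) ^ i| ≤ ∑ i ∈ p.support, |p.coeff i * (t : ℤ) ^ i| :=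
        Finset.abs_sum_le_sum_abs _ _
    _ ≤ ∑ i ∈ p.support, |p.coeff i| * (t : ℤ) ^ p.natDegree := by
        refine Finset.sum_le_sum fun i hi => ?_
        rw [abs_mul, abs_of_nonneg (by positivity : (0 : ℤ) ≤ (t : ℤ) ^ i)]
        exact mul_le_mul_of_nonneg_left
          (pow_le_pow_right₀ ht1 (Polynomial.le_natDegree_of_mem_supp i hi)) (abs_nonneg _)
    _ = C * (t : ℤ) ^ p.natDegree := by rw [← Finset.sum_mul]
    _ ≤ t * (t : ℤ) ^ p.natDegree := mul_le_mul_of_nonneg_right (by omega) (by positivity)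
    _ = (t : ℤ) ^ (p.natDegree + 1) := by ring

theorem poly_growth_fin {α : Type} [Fintype α] (p : α → Polynomial ℤ) :
    ∃ s N : ℕ, ∀ t : ℕ, N ≤ t → ∀ a, |(p a).eval (t : ℤ)| ≤ (t : ℤ) ^ s := by
  choose s N h using fun a => poly_growth (p a)
  refine ⟨∑ a, s a, ∑ a, N a + 1, fun t ht a => ?_⟩
  have h1 := Finset.single_le_sum (f := N) (fun _ _ => Nat.zero_le _) (Finset.mem_univ a)
  have h2 := Finset.single_le_sum (f := s) (fun _ _ => Nat.zero_le _) (Finset.mem_univ a)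
  exact (h a t (by omega)).trans (pow_le_pow_right₀ (by omega) h2)

theorem digits_surj (K t m : ℕ) (hm : m < t ^ K) :
    ∃ y : Fin K → ℕ, (∀ i, y i < t) ∧ ∑ i : Fin K, t ^ (i : ℕ) * y i = m := by
  refine ⟨fun i => (finFunctionFinEquiv.symm (⟨m, hm⟩ : Fin (t ^ K)) i : ℕ), fun i => Fin.is_lt _, ?_⟩
  have := finFunctionFinEquiv_apply (finFunctionFinEquiv.symm (⟨m, hm⟩ : Fin (t ^ K)))
  rw [Equiv.apply_symm_apply] at this
  simp only at this
  refine Eq.trans ?_ this.symm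
  exact Finset.sum_congr rfl fun i _ => mul_comm _ _

/-- The integer point with given digits. -/
def pt {n : ℕ} (r t : ℕ) (y : Fin n × Fin (r + 2) → ℕ) : Fin n → ℤ :=
  fun j => ((∑ i : Fin (r + 2), t ^ (i : ℕ) * y (j, i) : ℕ) : ℤ) - (t : ℤ) ^ r

theorem pt_inj {n : ℕ} (r t : ℕ) (y y' : Fin n × Fin (r + 2) → ℕ) (hy : ∀ v, y v < t)
    (hy' : ∀ v, y' v < t) (h : pt r t y = pt r t y') : y = y' := by
  funext ⟨j, i⟩
  have h1 := congrFun h j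
  simp only [pt, sub_left_inj] at h1
  have h2 := digits_inj (Equiv.refl (Fin (r + 2))) t (fun i => y (j, i)) (fun i => y' (j, i))
    (fun i => hy _) (fun i => hy' _) (by exact_mod_cast h1)
  exact congrFun h2 i

theorem pt_surj {n : ℕ} (r t : ℕ) (ht : 2 ≤ t) (x : Fin n → ℤ) (hx : ∀ j, |x j| ≤ (t : ℤ) ^ r) :
    ∃ y : Fin n × Fin (r + 2) → ℕ, (∀ v, y v < t) ∧ pt r t y = x := by
  have h : ∀ j, ∃ y : Fin (r + 2) → ℕ, (∀ i, y i < t) ∧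
      ∑ i : Fin (r + 2), t ^ (i : ℕ) * y i = (x j + (t : ℤ) ^ r).toNat := by
    intro j
    apply digits_surj
    have h1 := abs_le.1 (hx j)
    have h2 : (t : ℤ) ^ (r + 2) = (t : ℤ) ^ r * t * t := by ring
    have h3 : (0 : ℤ) < (t : ℤ) ^ r := by positivity
    have h4 : (2 : ℤ) ≤ t := by exact_mod_cast ht
    zify
    rw [Int.toNat_of_nonneg (by omega), h2]
    have h5 : (t : ℤ) ^ r * 2 ≤ (t : ℤ) ^ r * t := mul_le_mul_of_nonneg_left h4 h3.le
    nlinarith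
  choose y hy1 hy2 using h
  refine ⟨fun v => y v.1 v.2, fun v => hy1 _ _, ?_⟩
  funext j
  simp only [pt]
  rw [hy2 j, Int.toNat_of_nonneg (by have := (abs_le.1 (hx j)).1; omega)]
  ring

theorem pt_form {n : ℕ} (r t : ℕ) (y : Fin n × Fin (r + 2) → ℕ) (u : Fin n → Polynomial ℤ) :
    ∑ j, (u j).eval (t : ℤ) * pt r t y j =
      ∑ v : Fin n × Fin (r + 2), (u v.1 * Polynomial.X ^ (v.2 : ℕ)).eval (t : ℤ) * (y v : ℤ) -
        (∑ j, u j * Polynomial.X ^ r).eval (t : ℤ) := by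
  rw [Fintype.sum_prod_type, Polynomial.eval_finsetSum, ← Finset.sum_sub_distrib]
  refine Finset.sum_congr rfl fun j _ => ?_
  simp only [pt, mul_sub, Polynomial.eval_mul, Polynomial.eval_pow, Polynomial.eval_X]
  push_cast
  rw [Finset.mul_sum]
  simp only [mul_assoc]

theorem HB.boxSet (V : Type) [Fintype V] :
    HB {z : ℕ × (V → ℕ) | 0 < z.1 ∧ ∀ v, z.2 v < z.1} := by
  classical
  have h1 := HB.half_le (V := V) (fun _ => 0) (-1) (-1)
  have h2 := HB.biInter (Finset.univ : Finset V)
    (fun v => HB.half_le (V := V) (Pi.single v 1) (-1) (-1))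
  convert h1.inter h2 using 1
  ext z
  simp only [Set.mem_ofPred_eq, Set.mem_inter_iff, Set.mem_iInter, Finset.mem_univ, true_imp_iff,
    Pi.single_apply]
  simp
  constructor
  · rintro ⟨a, b⟩
    refine ⟨by omega, fun v => ?_⟩
    have := b v
    omega
  · rintro ⟨a, b⟩
    refine ⟨by omega, fun v => ?_⟩
    have := b v
    omega

/-- for a finite union of parametric polyhedra, bounded for each `t > 0`,
the number of lattice points is eventually quasi-polynomial, and each `ℓ`-th largest
value of the objective `c(t)·x` over the lattice points is eventually
quasi-polynomial. -/
theorem union_size_and_kth_largest_eqp (n : ℕ) (hn : 0 < n)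
    (c : Fin n → Polynomial ℤ)
    (ι : Type) [Fintype ι] (p : ι → ℕ)
    (A : ∀ i, Matrix (Fin (p i)) (Fin n) (Polynomial ℤ))
    (b : ∀ i, Fin (p i) → Polynomial ℤ)
    (hbdd : ∀ t : ℕ, 0 < t → Bornology.IsBounded
      (⋃ i, {x : Fin n → ℝ | ∀ k, ∑ j, (evalAt (A i k j) t : ℝ) * x j ≤ (evalAt (b i k) t : ℝ)})) :
    IsEQP (fun t => ((latticeUnion A b t).ncard : ℤ)) ∧
    ∀ ℓ : ℕ, 0 < ℓ → ∀ f : ℕ → WithBot ℤ,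
      (∀ t : ℕ, 0 < t → IsKthLargest (latticeUnion A b t)
        (fun x => ∑ j, evalAt (c j) t * x j) ℓ (f t)) →
      IsEQPBot f := by

  classical
  -- coefficient growth
  obtain ⟨s1, N1, hg1⟩ := poly_growth_fin
    (fun q : (Σ i, Fin (p i)) × Fin n => A q.1.1 q.1.2 q.2)
  obtain ⟨s2, N2, hg2⟩ := poly_growth_fin (fun q : (Σ i, Fin (p i)) => b q.1 q.2)
  obtain ⟨r, hr⟩ := poly_bound n (s1 + s2)
  -- the half-space Boolean set
  have hkey : ∀ i (k : Fin (p i)), ∃ S : Set (ℕ × (Fin n × Fin (r + 2) → ℕ)), HB S ∧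
      ∀ t y, 0 < t → (∀ v, y v < t) →
        ((t, y) ∈ S ↔ ∑ j, evalAt (A i k j) t * pt r t y j ≤ evalAt (b i k) t) := by
    intro i k
    obtain ⟨S, hS, hS'⟩ := key (fun v : Fin n × Fin (r + 2) => A i k v.1 * Polynomial.X ^ (v.2 : ℕ))
      (b i k + ∑ j, A i k j * Polynomial.X ^ r)
    refine ⟨S, hS, fun t y ht hy => ?_⟩
    rw [hS' t y ht hy]
    simp only [evalAt]
    rw [pt_form r t y (fun j => A i k j), Polynomial.eval_add, sub_le_iff_le_add]
  choose S hS hS' using hkey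
  set T : Set (ℕ × (Fin n × Fin (r + 2) → ℕ)) :=
    ⋃ i ∈ (Finset.univ : Finset ι), ⋂ k ∈ (Finset.univ : Finset (Fin (p i))), S i k with hT
  have hTHB : HB T := HB.biUnion _ fun i => HB.biInter _ fun k => hS i k
  have hTmem : ∀ t y, 0 < t → (∀ v, y v < t) → ((t, y) ∈ T ↔ pt r t y ∈ latticeUnion A b t) := by
    intro t y ht hy
    simp only [hT, Set.mem_iUnion, Set.mem_iInter, Finset.mem_univ, true_imp_iff, exists_prop,
      true_and, latticeUnion, Set.mem_ofPred_eq]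
    exact exists_congr fun i => forall_congr' fun k => hS' i k t y ht hy
  set N := max (max N1 N2) 2 with hN
  have himg : ∀ t, N ≤ t → latticeUnion A b t = pt r t '' {y | (∀ v, y v < t) ∧ (t, y) ∈ T} := by
    intro t ht
    have t1 : N1 ≤ t := by omega
    have t2 : N2 ≤ t := by omega
    have t3 : 2 ≤ t := by omega
    have t4 : (1 : ℤ) ≤ t := by omega
    ext x
    constructor
    · intro hx
      have hb : ∀ j, |x j| ≤ (t : ℤ) ^ r := by
        intro j
        obtain ⟨i, hi⟩ := hx
        have := hr t t3 (Fin (p i)) (fun k j => evalAt (A i k j) t) (fun k => evalAt (b i k) t)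
          (fun k j => (hg1 t t1 (⟨i, k⟩, j)).trans (pow_le_pow_right₀ t4 (by omega)))
          (fun k => (hg2 t t2 ⟨i, k⟩).trans (pow_le_pow_right₀ t4 (by omega)))
          ((hbdd t (by omega)).subset (Set.subset_iUnion
            (fun i => {x : Fin n → ℝ | ∀ k, ∑ j, (evalAt (A i k j) t : ℝ) * x j ≤ (evalAt (b i k) t : ℝ)}) i))
          (fun j => (x j : ℝ)) (fun k => by exact_mod_cast hi k) j
        exact_mod_cast this
      obtain ⟨y, hy, rfl⟩ := pt_surj r t t3 x hb
      exact ⟨y, ⟨hy, (hTmem t y (by omega) hy).2 hx⟩, rfl⟩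
    · rintro ⟨y, ⟨hy, hyT⟩, rfl⟩
      exact (hTmem t y (by omega) hy).1 hyT
  have hinj : ∀ t, Set.InjOn (pt r t)
      {y : Fin n × Fin (r + 2) → ℕ | (∀ v, y v < t) ∧ (t, y) ∈ T} :=
    fun t y hy y' hy' h => pt_inj r t y y' hy.1 hy'.1 h
  constructor
  · refine QP.isEQP ?_
    refine hTHB.count.congr_eventually N fun t ht => ?_
    rw [himg t ht, Set.InjOn.ncard_image (hinj t)]
    simp
  · intro ℓ hℓ f hf
    refine kth_main (T ∩ {z | 0 < z.1 ∧ ∀ v, z.2 v < z.1})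
      (hTHB.inter (HB.boxSet _)).semilinear (fun t y h => h.2)
      (fun v => c v.1 * Polynomial.X ^ (v.2 : ℕ)) (-∑ j, c j * Polynomial.X ^ r) ℓ hℓ f N ?_
    intro t ht
    have h1 := hf t (by omega)
    rw [himg t ht] at h1
    have h2 := kth_image (pt r t) (hinj t) _ ℓ _ h1
    have e1 : {y | (t, y) ∈ T ∩ {z | 0 < z.1 ∧ ∀ v, z.2 v < z.1}} =
        {y | (∀ v, y v < t) ∧ (t, y) ∈ T} := by
      ext y
      constructor
      · rintro ⟨a, _, b⟩
        exact ⟨b, a⟩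
      · rintro ⟨a, b⟩
        exact ⟨b, by omega, a⟩
    rw [e1]
    convert h2 using 2 with y
    simp only [evalAt]
    rw [pt_form r t y c, Polynomial.eval_neg, sub_eq_add_neg]
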